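/- arXiv:1909.00443 — 2 statements merged into one kernel-verified Lean document; each statement's English description precedes it below -/
import Mathlib

section
/- Assume K is algebraically closed of characteristic 0. Every simple sub-wheeled PROP 𝒜 of the mixed tensor algebra 𝒱 is finitely generated: there exists a finite subset F ⊆ ⋃_{p,q} 𝒜^p_q such that the smallest sub-wheeled PROP of 𝒱 containing F equals 𝒜. -/
/-- The component `𝒱^p_q = (V*)^⊗p ⊗ V^⊗q` of the mixed tensor algebra on an
`d`-dimensional vector space `V`, realized concretely in coordinates: a tensor is
the array of its coefficients `A^{x_1,…,x_p}_{y_1,…,y_q}`. -/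
abbrev MixT (K : Type) (d p q : ℕ) : Type := (Fin p → Fin d) → (Fin q → Fin d) → K

/-- The unit `1 ∈ 𝒱^0_0 = K`. -/
def munit (K : Type) [One K] (d : ℕ) : MixT K d 0 0 := fun _ _ => 1

/-- The identity tensor `id ∈ 𝒱^1_1 ≅ End(V)`. -/
def mid (K : Type) [One K] [Zero K] (d : ℕ) : MixT K d 1 1 :=
  fun x y => if x 0 = y 0 then 1 else 0

/-- The tensor product `⊗ : 𝒱^{p₁}_{q₁} × 𝒱^{p₂}_{q₂} → 𝒱^{p₁+p₂}_{q₁+q₂}`,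
juxtaposing the `V*`-factors and the `V`-factors. -/
def mtens {K : Type} [Mul K] {d p₁ q₁ p₂ q₂ : ℕ}
    (A : MixT K d p₁ q₁) (B : MixT K d p₂ q₂) : MixT K d (p₁ + p₂) (q₁ + q₂) :=
  fun x y =>
    A (fun a => x (Fin.castAdd p₂ a)) (fun b => y (Fin.castAdd q₂ b)) *
    B (fun a => x (Fin.natAdd p₁ a)) (fun b => y (Fin.natAdd q₁ b))

/-- The contraction `∂^i_j : 𝒱^{p+1}_{q+1} → 𝒱^p_q`, evaluating the `i`-th
`V*`-factor on the `j`-th `V`-factor. -/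
def mcontr {K : Type} [AddCommMonoid K] {d p q : ℕ} (i : Fin (p + 1)) (j : Fin (q + 1))
    (A : MixT K d (p + 1) (q + 1)) : MixT K d p q :=
  fun x y => ∑ k : Fin d, A (i.insertNth k x) (j.insertNth k y)

/-- The trace pairing `⟨·,·⟩ : 𝒱^p_q × 𝒱^q_p → K`: the full contraction,
i.e. the trace of the composition `B ∘ A : V^⊗p → V^⊗p`. -/
def mpair {K : Type} [CommRing K] {d p q : ℕ} (A : MixT K d p q) (B : MixT K d q p) : K :=
  ∑ x : Fin p → Fin d, ∑ y : Fin q → Fin d, A x y * B y x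

/-- A sub-wheeled PROP of the mixed tensor algebra `𝒱`: a family of `K`-subspaces
`𝒜^p_q ⊆ 𝒱^p_q` containing `1` and `id`, closed under tensor product and under
all contractions. -/
structure SubProp (K : Type) [Field K] (d : ℕ) where
  mem : ∀ p q : ℕ, Set (MixT K d p q)
  unit_mem : munit K d ∈ mem 0 0
  id_mem : mid K d ∈ mem 1 1
  zero_mem : ∀ p q : ℕ, (0 : MixT K d p q) ∈ mem p q
  add_mem : ∀ (p q : ℕ) (A B : MixT K d p q),
    A ∈ mem p q → B ∈ mem p q → A + B ∈ mem p q
  smul_mem : ∀ (p q : ℕ) (c : K) (A : MixT K d p q), A ∈ mem p q → c • A ∈ mem p q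
  tens_mem : ∀ (p₁ q₁ p₂ q₂ : ℕ) (A : MixT K d p₁ q₁) (B : MixT K d p₂ q₂),
    A ∈ mem p₁ q₁ → B ∈ mem p₂ q₂ → mtens A B ∈ mem (p₁ + p₂) (q₁ + q₂)
  contr_mem : ∀ (p q : ℕ) (i : Fin (p + 1)) (j : Fin (q + 1)) (A : MixT K d (p + 1) (q + 1)),
    A ∈ mem (p + 1) (q + 1) → mcontr i j A ∈ mem p q

/-- An ideal of a sub-wheeled PROP `𝒜` of `𝒱`: a family of `K`-subspaces
`I^p_q ⊆ 𝒜^p_q` absorbing under tensor product with elements of `𝒜` (on either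
side) and closed under all contractions. -/
structure PropIdeal {K : Type} [Field K] {d : ℕ} (𝒜 : SubProp K d) where
  mem : ∀ p q : ℕ, Set (MixT K d p q)
  subset : ∀ p q : ℕ, mem p q ⊆ 𝒜.mem p q
  zero_mem : ∀ p q : ℕ, (0 : MixT K d p q) ∈ mem p q
  add_mem : ∀ (p q : ℕ) (A B : MixT K d p q),
    A ∈ mem p q → B ∈ mem p q → A + B ∈ mem p q
  smul_mem : ∀ (p q : ℕ) (c : K) (A : MixT K d p q), A ∈ mem p q → c • A ∈ mem p q
  tens_mem_left : ∀ (p₁ q₁ p₂ q₂ : ℕ) (A : MixT K d p₁ q₁) (B : MixT K d p₂ q₂),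
    A ∈ 𝒜.mem p₁ q₁ → B ∈ mem p₂ q₂ → mtens A B ∈ mem (p₁ + p₂) (q₁ + q₂)
  tens_mem_right : ∀ (p₁ q₁ p₂ q₂ : ℕ) (A : MixT K d p₁ q₁) (B : MixT K d p₂ q₂),
    A ∈ 𝒜.mem p₁ q₁ → B ∈ mem p₂ q₂ → mtens B A ∈ mem (p₂ + p₁) (q₂ + q₁)
  contr_mem : ∀ (p q : ℕ) (i : Fin (p + 1)) (j : Fin (q + 1)) (A : MixT K d (p + 1) (q + 1)),
    A ∈ mem (p + 1) (q + 1) → mcontr i j A ∈ mem p q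

/-- A sub-wheeled PROP is simple if its only ideals are `0` and itself. -/
def SubProp.IsSimple {K : Type} [Field K] {d : ℕ} (𝒜 : SubProp K d) : Prop :=
  ∀ I : PropIdeal 𝒜,
    (∀ p q : ℕ, I.mem p q = {0}) ∨ (∀ p q : ℕ, I.mem p q = 𝒜.mem p q)

section Basics
variable {K : Type} [Field K] {d : ℕ}

theorem SubProp.cyc_left (𝒜 : SubProp K d) {p q : ℕ} (i : Fin (p + 1)) (A : MixT K d (p + 1) q)
    (hA : A ∈ 𝒜.mem (p + 1) q) :
    (fun x y => A (fun a => Fin.insertNth (α := fun _ => Fin d) i.castSucc (x (Fin.last p)) x a.castSucc) y) ∈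
      𝒜.mem (p + 1) q := by
  have h := 𝒜.contr_mem (p + 1) q i.castSucc (Fin.last q) _
    (𝒜.tens_mem _ _ _ _ A (mid K d) hA 𝒜.id_mem)
  convert h using 1
  funext x y
  simp only [mcontr, mtens, mid]
  have h1 : ∀ k : Fin d, Fin.insertNth (α := fun _ => Fin d) i.castSucc k x
      (Fin.natAdd (p + 1) (0 : Fin 1)) = x (Fin.last p) := by
    intro k
    have : (Fin.natAdd (p + 1) (0 : Fin 1)) = i.castSucc.succAbove (Fin.last p) := by
      rw [Fin.succAbove_of_le_castSucc]
      · rfl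
      · exact Fin.castSucc_le_castSucc_iff.mpr (Fin.le_last i)
    rw [this]
    exact Fin.insertNth_apply_succAbove _ _ _ _
  have h2 : ∀ k : Fin d, Fin.insertNth (α := fun _ => Fin d) (Fin.last q) k y
      (Fin.natAdd q (0 : Fin 1)) = k := by
    intro k
    exact Fin.insertNth_apply_same (α := fun _ => Fin d) (Fin.last q) k y
  have h3 : ∀ k : Fin d, (fun b => Fin.insertNth (α := fun _ => Fin d) (Fin.last q) k y
      (Fin.castAdd 1 b)) = y := by
    intro k
    funext b
    have : Fin.castAdd 1 b = (Fin.last q).succAbove b := by simp; rfl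
    rw [this]
    exact Fin.insertNth_apply_succAbove _ _ _ _
  simp only [h1, h2, h3, mul_ite, mul_one, mul_zero]
  rw [Finset.sum_ite_eq]
  simp
  rfl

theorem SubProp.cyc_right (𝒜 : SubProp K d) {p q : ℕ} (i : Fin (q + 1)) (A : MixT K d p (q + 1))
    (hA : A ∈ 𝒜.mem p (q + 1)) :
    (fun x y => A x (fun a => Fin.insertNth (α := fun _ => Fin d) i.castSucc (y (Fin.last q)) y a.castSucc)) ∈
      𝒜.mem p (q + 1) := by
  have h := 𝒜.contr_mem p (q + 1) (Fin.last p) i.castSucc _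
    (𝒜.tens_mem _ _ _ _ A (mid K d) hA 𝒜.id_mem)
  convert h using 1
  funext x y
  simp only [mcontr, mtens, mid]
  have h1 : ∀ k : Fin d, Fin.insertNth (α := fun _ => Fin d) i.castSucc k y
      (Fin.natAdd (q + 1) (0 : Fin 1)) = y (Fin.last q) := by
    intro k
    have : (Fin.natAdd (q + 1) (0 : Fin 1)) = i.castSucc.succAbove (Fin.last q) := by
      rw [Fin.succAbove_of_le_castSucc]
      · rfl
      · exact Fin.castSucc_le_castSucc_iff.mpr (Fin.le_last i)
    rw [this]
    exact Fin.insertNth_apply_succAbove _ _ _ _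
  have h2 : ∀ k : Fin d, Fin.insertNth (α := fun _ => Fin d) (Fin.last p) k x
      (Fin.natAdd p (0 : Fin 1)) = k := by
    intro k
    exact Fin.insertNth_apply_same (α := fun _ => Fin d) (Fin.last p) k x
  have h3 : ∀ k : Fin d, (fun b => Fin.insertNth (α := fun _ => Fin d) (Fin.last p) k x
      (Fin.castAdd 1 b)) = x := by
    intro k
    funext b
    have : Fin.castAdd 1 b = (Fin.last p).succAbove b := by simp; rfl
    rw [this]
    exact Fin.insertNth_apply_succAbove _ _ _ _
  simp only [h1, h2, h3, mul_ite, mul_one, mul_zero]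
  rw [Finset.sum_ite_eq']
  simp
  rfl

theorem ins_rotate {p : ℕ} (x : Fin (p + 1) → Fin d) :
    (fun a : Fin (p + 1) => Fin.insertNth (α := fun _ => Fin d) (0 : Fin (p + 1)).castSucc
      (x (Fin.last p)) x a.castSucc) = x ∘ ((finRotate (p + 1))⁻¹ : Equiv.Perm (Fin (p + 1))) := by
  funext a
  obtain ⟨b, rfl⟩ := (finRotate (p + 1)).surjective a
  have hb : ((finRotate (p + 1))⁻¹ : Equiv.Perm (Fin (p + 1))) (finRotate (p + 1) b) = b :=
    Equiv.symm_apply_apply _ _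
  rw [Function.comp_apply, hb]
  induction b using Fin.lastCases with
  | last =>
    rw [finRotate_last]
    simp
  | cast b =>
    have : finRotate (p + 1) b.castSucc = b.succ := by
      simp [finRotate_apply]
    rw [this]
    have : b.succ.castSucc = (0 : Fin (p + 1)).castSucc.succAbove b.castSucc := by simp
    rw [this, Fin.insertNth_apply_succAbove]

theorem ins_swap {p : ℕ} (x : Fin (p + 2) → Fin d) :
    (fun a : Fin (p + 2) => Fin.insertNth (α := fun _ => Fin d)
      (Fin.last p).castSucc.castSucc
      (x (Fin.last (p + 1))) x a.castSucc) =
      x ∘ (Equiv.swap (Fin.last (p + 1)) (Fin.last p).castSucc) := by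
  funext a
  rw [Function.comp_apply]
  induction a using Fin.lastCases with
  | last =>
    rw [Equiv.swap_apply_left]
    have : (Fin.last (p + 1)).castSucc =
      (Fin.last p).castSucc.castSucc.succAbove (Fin.last p).castSucc := by
      rw [Fin.succAbove_of_le_castSucc]
      · rfl
      · rfl
    rw [this, Fin.insertNth_apply_succAbove]
  | cast b =>
    induction b using Fin.lastCases with
    | last => rw [Equiv.swap_apply_right, Fin.insertNth_apply_same]
    | cast b =>
      rw [Equiv.swap_apply_of_ne_of_ne]
      · have : b.castSucc.castSucc.castSucc =
          (Fin.last p).castSucc.castSucc.succAbove b.castSucc.castSucc := by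
          rw [Fin.succAbove_of_castSucc_lt]
          simp [Fin.lt_def]
        rw [this, Fin.insertNth_apply_succAbove]
      · simp [Fin.ext_iff]; omega
      · simp [Fin.ext_iff]; omega

theorem perm_gen {p : ℕ} (S : Submonoid (Equiv.Perm (Fin (p + 2))))
    (h1 : (finRotate (p + 2))⁻¹ ∈ S)
    (h2 : Equiv.swap (Fin.last (p + 1)) (Fin.last p).castSucc ∈ S)
    (σ : Equiv.Perm (Fin (p + 2))) : σ ∈ S := by
  have hc := Equiv.Perm.closure_cycle_adjacent_swap (σ := (finRotate (p + 2))⁻¹)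
    isCycle_finRotate.inv (by rw [Equiv.Perm.support_inv, support_finRotate]) (Fin.last (p + 1))
  have h3 : (finRotate (p + 2))⁻¹ (Fin.last (p + 1)) = (Fin.last p).castSucc := by
    rw [Equiv.Perm.inv_eq_iff_eq]
    simp
  rw [h3] at hc
  have := Subgroup.closure_toSubmonoid_of_finite (s := 
    {(finRotate (p + 2))⁻¹, Equiv.swap (Fin.last (p + 1)) (Fin.last p).castSucc})
  rw [hc] at this
  have h4 : σ ∈ (⊤ : Subgroup (Equiv.Perm (Fin (p + 2)))).toSubmonoid := by simp
  rw [this] at h4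
  refine Submonoid.closure_le.mpr ?_ h4
  rintro x (rfl | rfl)
  · exact h1
  · exact h2

theorem SubProp.perm_left (𝒜 : SubProp K d) {p q : ℕ} (σ : Equiv.Perm (Fin p)) (A : MixT K d p q)
    (hA : A ∈ 𝒜.mem p q) : (fun x y => A (x ∘ σ) y) ∈ 𝒜.mem p q := by
  rcases p with _ | _ | p
  · convert hA using 4
  · obtain rfl : σ = 1 := Subsingleton.elim (α := Equiv.Perm (Fin 1)) _ _
    exact hA
  let S : Submonoid (Equiv.Perm (Fin (p + 2))) :=
    { carrier := {σ | ∀ A ∈ 𝒜.mem (p + 2) q, (fun x y => A (x ∘ σ) y) ∈ 𝒜.mem (p + 2) q}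
      one_mem' := fun A hA => hA
      mul_mem' := fun {a b} ha hb A hA => ha _ (hb A hA) }
  refine perm_gen S ?_ ?_ σ A hA
  · intro A hA
    have := 𝒜.cyc_left 0 A hA
    simpa only [ins_rotate] using this
  · intro A hA
    have := 𝒜.cyc_left (Fin.last p).castSucc A hA
    simpa only [ins_swap] using this

theorem SubProp.perm_right (𝒜 : SubProp K d) {p q : ℕ} (σ : Equiv.Perm (Fin q)) (A : MixT K d p q)
    (hA : A ∈ 𝒜.mem p q) : (fun x y => A x (y ∘ σ)) ∈ 𝒜.mem p q := by
  rcases q with _ | _ | q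
  · convert hA using 4
  · obtain rfl : σ = 1 := Subsingleton.elim (α := Equiv.Perm (Fin 1)) _ _
    exact hA
  let S : Submonoid (Equiv.Perm (Fin (q + 2))) :=
    { carrier := {σ | ∀ A ∈ 𝒜.mem p (q + 2), (fun x y => A x (y ∘ σ)) ∈ 𝒜.mem p (q + 2)}
      one_mem' := fun A hA => hA
      mul_mem' := fun {a b} ha hb A hA => ha _ (hb A hA) }
  refine perm_gen S ?_ ?_ σ A hA
  · intro A hA
    have := 𝒜.cyc_right 0 A hA
    simpa only [ins_rotate] using this
  · intro A hA
    have := 𝒜.cyc_right (Fin.last q).castSucc A hA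
    simpa only [ins_swap] using this

theorem SubProp.perm_mem (𝒜 : SubProp K d) {p q : ℕ} (σ : Equiv.Perm (Fin p))
    (τ : Equiv.Perm (Fin q)) (A : MixT K d p q)
    (hA : A ∈ 𝒜.mem p q) : (fun x y => A (x ∘ σ) (y ∘ τ)) ∈ 𝒜.mem p q :=
  𝒜.perm_left σ _ (𝒜.perm_right τ A hA)

/-- Membership in a sub-wheeled PROP for tensors with slots labelled by arbitrary finite types. -/
def SubProp.MemT (𝒜 : SubProp K d) {I J : Type} (T : (I → Fin d) → (J → Fin d) → K) : Prop :=
  ∃ (p q : ℕ) (e : I ≃ Fin p) (f : J ≃ Fin q), (fun x y => T (x ∘ e) (y ∘ f)) ∈ 𝒜.mem p q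

theorem SubProp.MemT.all {𝒜 : SubProp K d} {I J : Type} {T : (I → Fin d) → (J → Fin d) → K}
    (h : 𝒜.MemT T) {p q : ℕ} (e : I ≃ Fin p) (f : J ≃ Fin q) :
    (fun x y => T (x ∘ e) (y ∘ f)) ∈ 𝒜.mem p q := by
  obtain ⟨p', q', e', f', h⟩ := h
  obtain rfl : p' = p := by simpa using Fintype.card_congr (e'.symm.trans e)
  obtain rfl : q' = q := by simpa using Fintype.card_congr (f'.symm.trans f)
  have := 𝒜.perm_mem (e'.symm.trans e) (f'.symm.trans f) _ h
  convert this using 4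
  · funext a; simp
  · funext a; simp

theorem SubProp.memT_iff (𝒜 : SubProp K d) {p q : ℕ} (A : MixT K d p q) :
    𝒜.MemT A ↔ A ∈ 𝒜.mem p q :=
  ⟨fun h => h.all (Equiv.refl _) (Equiv.refl _), fun h => ⟨p, q, Equiv.refl _, Equiv.refl _, h⟩⟩

theorem SubProp.MemT.reindex {𝒜 : SubProp K d} {I J I' J' : Type}
    {T : (I → Fin d) → (J → Fin d) → K}
    (h : 𝒜.MemT T) (α : I ≃ I') (β : J ≃ J') : 𝒜.MemT (fun x y => T (x ∘ α) (y ∘ β)) := by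
  obtain ⟨p, q, e, f, h⟩ := h
  refine ⟨p, q, α.symm.trans e, β.symm.trans f, ?_⟩
  convert h using 4
  · funext a; simp
  · funext a; simp

theorem SubProp.MemT.tens {𝒜 : SubProp K d} {I J I' J' : Type}
    {T : (I → Fin d) → (J → Fin d) → K} {S : (I' → Fin d) → (J' → Fin d) → K}
    (h : 𝒜.MemT T) (h' : 𝒜.MemT S) :
    𝒜.MemT (fun (x : I ⊕ I' → Fin d) (y : J ⊕ J' → Fin d) =>
      T (x ∘ Sum.inl) (y ∘ Sum.inl) * S (x ∘ Sum.inr) (y ∘ Sum.inr)) := by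
  obtain ⟨p, q, e, f, h⟩ := h
  obtain ⟨p', q', e', f', h'⟩ := h'
  refine ⟨p + p', q + q', (Equiv.sumCongr e e').trans finSumFinEquiv,
    (Equiv.sumCongr f f').trans finSumFinEquiv, ?_⟩
  have := 𝒜.tens_mem _ _ _ _ _ _ h h'
  convert this using 1
  funext x y
  simp only [mtens]
  congr 2

theorem SubProp.MemT.contr {𝒜 : SubProp K d} {I J : Type}
    {T : (Option I → Fin d) → (Option J → Fin d) → K} [Finite I] [Finite J]
    (h : 𝒜.MemT T) :
    𝒜.MemT (fun (x : I → Fin d) (y : J → Fin d) =>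
      ∑ k : Fin d, T (fun o => o.elim k x) (fun o => o.elim k y)) := by
  obtain ⟨p, ⟨e⟩⟩ := Finite.exists_equiv_fin I
  obtain ⟨q, ⟨f⟩⟩ := Finite.exists_equiv_fin J
  refine ⟨p, q, e, f, ?_⟩
  have := 𝒜.contr_mem p q 0 0 _ (h.all ((Equiv.optionCongr e).trans (finSuccEquiv p).symm)
    ((Equiv.optionCongr f).trans (finSuccEquiv q).symm))
  convert this using 1
  funext x y
  simp only [mcontr]
  refine Finset.sum_congr rfl fun k _ => ?_
  congr 1
  · funext o
    cases o <;> simp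
  · funext o
    cases o <;> simp

end Basics
section Pairing
variable {K : Type} [Field K] {d : ℕ}

theorem SubProp.MemT.contrN {𝒜 : SubProp K d} (n : ℕ) {I J : Type} [Finite I] [Finite J]
    {T : (Fin n ⊕ I → Fin d) → (Fin n ⊕ J → Fin d) → K} 
    (h : 𝒜.MemT T) :
    𝒜.MemT (fun (x : I → Fin d) (y : J → Fin d) =>
      ∑ u : Fin n → Fin d, T (Sum.elim u x) (Sum.elim u y)) := by
  induction n with
  | zero =>
    have := h.reindex (Equiv.emptySum (Fin 0) I) (Equiv.emptySum (Fin 0) J)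
    convert this using 3 with x y
    rw [Fintype.sum_unique]
    congr 1
    · funext a; rcases a with a | a
      · exact a.elim0
      · rfl
    · funext a; rcases a with a | a
      · exact a.elim0
      · rfl
  | succ n ih =>
    let E : ∀ I : Type, (Fin (n + 1) ⊕ I) ≃ Option (Fin n ⊕ I) := fun I =>
      { toFun := Sum.elim (Fin.cases none (fun a => some (Sum.inl a))) (fun i => some (Sum.inr i))
        invFun := fun o => o.elim (Sum.inl 0) (Sum.elim (fun a => Sum.inl a.succ) Sum.inr)
        left_inv := by
          rintro (a | i)
          · induction a using Fin.cases <;> simp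
          · simp
        right_inv := by
          rintro (_ | a | i) <;> simp }
    have h1 := ih (h.reindex (E I) (E J)).contr
    convert h1 using 3 with x y
    rw [← (Fin.consEquiv (fun _ => Fin d)).sum_comp, Fintype.sum_prod_type, Finset.sum_comm]
    refine Finset.sum_congr rfl fun u _ => Finset.sum_congr rfl fun k _ => ?_
    congr 1
    · funext a; rcases a with a | a
      · induction a using Fin.cases <;> simp [E, Fin.consEquiv]
      · simp [E]
    · funext a; rcases a with a | a
      · induction a using Fin.cases <;> simp [E, Fin.consEquiv]
      · simp [E]

theorem SubProp.MemT.pcontr {𝒜 : SubProp K d} {p q : ℕ} {I J : Type} [Finite I] [Finite J]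
    {A : MixT K d p q} {C : (Fin q ⊕ I → Fin d) → (Fin p ⊕ J → Fin d) → K}
    (hA : 𝒜.MemT A) (hC : 𝒜.MemT C) :
    𝒜.MemT (fun (y : I → Fin d) (x : J → Fin d) =>
      ∑ y1 : Fin q → Fin d, ∑ x1 : Fin p → Fin d,
        A x1 y1 * C (Sum.elim y1 y) (Sum.elim x1 x)) := by
  let E : (Fin q ⊕ (Fin p ⊕ J)) ≃ (Fin p ⊕ (Fin q ⊕ J)) :=
    { toFun := Sum.elim (fun a => Sum.inr (Sum.inl a))
        (Sum.elim Sum.inl (fun a => Sum.inr (Sum.inr a)))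
      invFun := Sum.elim (fun a => Sum.inr (Sum.inl a))
        (Sum.elim Sum.inl (fun a => Sum.inr (Sum.inr a)))
      left_inv := by rintro (a | a | a) <;> simp
      right_inv := by rintro (a | a | a) <;> simp }
  exact (((hA.tens hC).reindex (Equiv.refl _) E).contrN p).contrN q |> fun h => by
    convert h using 6 with y x y1 _ x1 _
    · congr 1
    · congr 1
      funext a
      rcases a with a | a <;> simp [E]

/-- The tensor product, with an arbitrary distribution of the slots. -/
def glue {p₁ q₁ p₂ q₂ p q : ℕ} (α : Fin p₁ ⊕ Fin p₂ ≃ Fin p) (β : Fin q₁ ⊕ Fin q₂ ≃ Fin q)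
    (A : MixT K d p₁ q₁) (T : MixT K d p₂ q₂) : MixT K d p q := fun x y =>
  A (fun a => x (α (Sum.inl a))) (fun a => y (β (Sum.inl a))) *
    T (fun a => x (α (Sum.inr a))) (fun a => y (β (Sum.inr a)))

theorem glue_mem (𝒜 : SubProp K d) {p₁ q₁ p₂ q₂ p q : ℕ} (α : Fin p₁ ⊕ Fin p₂ ≃ Fin p)
    (β : Fin q₁ ⊕ Fin q₂ ≃ Fin q) {A : MixT K d p₁ q₁} {T : MixT K d p₂ q₂}
    (hA : A ∈ 𝒜.mem p₁ q₁) (hT : T ∈ 𝒜.mem p₂ q₂) : glue α β A T ∈ 𝒜.mem p q := by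
  rw [← SubProp.memT_iff] at *
  exact (hA.tens hT).reindex α β

theorem sum_split {M : Type} [AddCommMonoid M] {p₁ p₂ p : ℕ} (α : Fin p₁ ⊕ Fin p₂ ≃ Fin p)
    (f : (Fin p → Fin d) → M) :
    ∑ x, f x = ∑ x1 : Fin p₁ → Fin d, ∑ x2 : Fin p₂ → Fin d, f (Sum.elim x1 x2 ∘ α.symm) := by
  rw [← Fintype.sum_prod_type' (f := fun (x1 : Fin p₁ → Fin d) (x2 : Fin p₂ → Fin d) =>
    f (Sum.elim x1 x2 ∘ α.symm))]
  refine (Fintype.sum_equiv ((Equiv.sumArrowEquivProdArrow _ _ _).symm.trans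
    (Equiv.arrowCongr α (Equiv.refl _))) _ _ ?_).symm
  rintro ⟨a, b⟩
  rfl

theorem glue_pair (𝒜 : SubProp K d) {p₁ q₁ p₂ q₂ p q : ℕ} (α : Fin p₁ ⊕ Fin p₂ ≃ Fin p)
    (β : Fin q₁ ⊕ Fin q₂ ≃ Fin q) {A : MixT K d p₁ q₁} {B : MixT K d q p}
    (hA : A ∈ 𝒜.mem p₁ q₁) (hB : B ∈ 𝒜.mem q p) :
    ∃ B' ∈ 𝒜.mem q₂ p₂, ∀ T : MixT K d p₂ q₂, mpair (glue α β A T) B = mpair T B' := by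
  rw [← SubProp.memT_iff] at hA hB
  have h := hA.pcontr (hB.reindex β.symm α.symm)
  refine ⟨_, (𝒜.memT_iff _).mp h, fun T => ?_⟩
  simp only [mpair, glue]
  rw [sum_split α, Finset.sum_comm]
  refine Finset.sum_congr rfl fun x2 _ => ?_
  simp only [sum_split β]
  rw [Finset.sum_congr rfl fun x1 _ => Finset.sum_comm, Finset.sum_comm]
  refine Finset.sum_congr rfl fun y2 _ => ?_
  rw [Finset.mul_sum, Finset.sum_comm]
  refine Finset.sum_congr rfl fun y1 _ => ?_
  rw [Finset.mul_sum]
  refine Finset.sum_congr rfl fun x1 _ => ?_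
  simp
  ring

theorem mtens_eq_glue {p₁ q₁ p₂ q₂ : ℕ} (A : MixT K d p₁ q₁) (T : MixT K d p₂ q₂) :
    mtens A T = glue finSumFinEquiv finSumFinEquiv A T := rfl

theorem mtens_eq_glue' {p₁ q₁ p₂ q₂ : ℕ} (A : MixT K d p₁ q₁) (T : MixT K d p₂ q₂) :
    mtens T A = glue ((Equiv.sumComm _ _).trans finSumFinEquiv)
      ((Equiv.sumComm _ _).trans finSumFinEquiv) A T := by
  funext x y
  simp only [mtens, glue]
  rw [mul_comm]
  rfl

theorem contr_pair (𝒜 : SubProp K d) {p q : ℕ} (i : Fin (p + 1)) (j : Fin (q + 1))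
    {B : MixT K d q p} (hB : B ∈ 𝒜.mem q p) :
    ∃ B' ∈ 𝒜.mem (q + 1) (p + 1), ∀ A : MixT K d (p + 1) (q + 1),
      mpair (mcontr i j A) B = mpair A B' := by
  let E : ∀ {n : ℕ} (i : Fin (n + 1)), (Fin 1 ⊕ Fin n) ≃ Fin (n + 1) := fun {n} i =>
    ((Equiv.sumComm _ _).trans (Equiv.sumCongr (Equiv.refl _)
      (Equiv.ofUnique (Fin 1) PUnit.{1}))).trans ((Equiv.optionEquivSumPUnit _).symm.trans
        (finSuccEquiv' i).symm)
  have E0 : ∀ {n : ℕ} (i : Fin (n + 1)), E i (Sum.inl 0) = i := by intro n i; simp [E]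
  have E1 : ∀ {n : ℕ} (i : Fin (n + 1)) (a : Fin n), E i (Sum.inr a) = i.succAbove a := by
    intro n i a; simp [E]
  refine ⟨glue (E j) (E i) (mid K d) B, glue_mem 𝒜 _ _ 𝒜.id_mem hB, fun A => ?_⟩
  have hs : ∀ {n : ℕ} (i : Fin (n + 1)) (f : (Fin (n + 1) → Fin d) → K), ∑ x, f x =
      ∑ k : Fin d, ∑ x : Fin n → Fin d, f (i.insertNth k x) := by
    intro n i f
    rw [← (Fin.insertNthEquiv (fun _ => Fin d) i).sum_comp, Fintype.sum_prod_type]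
    rfl
  simp only [mpair, glue, mid, mcontr, E0, E1]
  rw [hs i]
  conv_rhs => rw [Finset.sum_comm]
  refine Finset.sum_congr rfl fun x _ => ?_
  simp only [hs j, Fin.insertNth_apply_same, Fin.insertNth_apply_succAbove]
  simp only [Finset.sum_mul]
  rw [Finset.sum_comm]
  refine Finset.sum_congr rfl fun k _ => ?_
  rw [Finset.sum_comm]
  refine Finset.sum_congr rfl fun y _ => ?_
  simp

/-- Pairing as a bilinear map. -/
def bpair (K : Type) [Field K] (d p q : ℕ) : MixT K d p q →ₗ[K] MixT K d q p →ₗ[K] K :=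
  LinearMap.mk₂ K mpair
    (fun A A' B => by simp [mpair, add_mul, Finset.sum_add_distrib])
    (fun c A B => by simp [mpair, mul_assoc, Finset.mul_sum])
    (fun A B B' => by simp [mpair, mul_add, Finset.sum_add_distrib])
    (fun c A B => by simp [mpair, mul_left_comm, Finset.mul_sum])

/-- Component as a submodule. -/
def SubProp.sub (𝒜 : SubProp K d) (p q : ℕ) : Submodule K (MixT K d p q) where
  carrier := 𝒜.mem p q
  add_mem' := fun {a b} ha hb => 𝒜.add_mem p q a b ha hb
  zero_mem' := 𝒜.zero_mem p q
  smul_mem' := fun c a ha => 𝒜.smul_mem p q c a ha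

/-- The radical of the trace pairing. -/
def radIdeal (𝒜 : SubProp K d) : PropIdeal 𝒜 where
  mem p q := {A | A ∈ 𝒜.mem p q ∧ ∀ B ∈ 𝒜.mem q p, mpair A B = 0}
  subset p q A hA := hA.1
  zero_mem p q := ⟨𝒜.zero_mem p q, fun B _ => by simp [mpair]⟩
  add_mem p q A A' hA hA' := ⟨𝒜.add_mem _ _ _ _ hA.1 hA'.1, fun B hB => by
    have : mpair (A + A') B = mpair A B + mpair A' B := (bpair K d p q).map_add₂ A A' B
    rw [this, hA.2 B hB, hA'.2 B hB, add_zero]⟩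
  smul_mem p q c A hA := ⟨𝒜.smul_mem _ _ _ _ hA.1, fun B hB => by
    have : mpair (c • A) B = c • mpair A B := (bpair K d p q).map_smul₂ c A B
    rw [this, hA.2 B hB, smul_zero]⟩
  tens_mem_left p₁ q₁ p₂ q₂ A B hA hB := ⟨𝒜.tens_mem _ _ _ _ _ _ hA hB.1, fun C hC => by
    rw [mtens_eq_glue]
    obtain ⟨B', hB', h⟩ := glue_pair 𝒜 finSumFinEquiv finSumFinEquiv hA hC
    rw [h, hB.2 _ hB']⟩
  tens_mem_right p₁ q₁ p₂ q₂ A B hA hB := ⟨𝒜.tens_mem _ _ _ _ _ _ hB.1 hA, fun C hC => by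
    rw [mtens_eq_glue']
    obtain ⟨B', hB', h⟩ := glue_pair 𝒜 ((Equiv.sumComm _ _).trans finSumFinEquiv)
      ((Equiv.sumComm _ _).trans finSumFinEquiv) hA hC
    rw [h, hB.2 _ hB']⟩
  contr_mem p q i j A hA := ⟨𝒜.contr_mem _ _ _ _ _ hA.1, fun C hC => by
    obtain ⟨B', hB', h⟩ := contr_pair 𝒜 i j hC
    rw [h, hA.2 _ hB']⟩

theorem nondeg (𝒜 : SubProp K d) (hA : 𝒜.IsSimple) {p q : ℕ} (A : MixT K d p q)
    (h : A ∈ 𝒜.mem p q) (h0 : ∀ B ∈ 𝒜.mem q p, mpair A B = 0) : A = 0 := by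
  rcases hA (radIdeal 𝒜) with h1 | h1
  · have : A ∈ (radIdeal 𝒜).mem p q := ⟨h, h0⟩
    rw [h1] at this
    exact this
  · have : munit K d ∈ (radIdeal 𝒜).mem 0 0 := by rw [h1]; exact 𝒜.unit_mem
    have := this.2 _ 𝒜.unit_mem
    simp [mpair, munit] at this

theorem exists_proj (𝒜 : SubProp K d) (hA : 𝒜.IsSimple) (p q : ℕ) :
    ∃ π : MixT K d p q →ₗ[K] MixT K d p q, (∀ T, π T ∈ 𝒜.mem p q) ∧
      ∀ T, ∀ B ∈ 𝒜.mem q p, mpair (π T) B = mpair T B := by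
  let b : 𝒜.sub p q →ₗ[K] 𝒜.sub q p →ₗ[K] K :=
    (bpair K d p q).compl₁₂ (𝒜.sub p q).subtype (𝒜.sub q p).subtype
  have hb1 : Function.Injective b := by
    rw [injective_iff_map_eq_zero]
    rintro ⟨A, hAm⟩ h
    have : A = 0 := nondeg 𝒜 hA A hAm fun B hB => LinearMap.congr_fun h ⟨B, hB⟩
    simpa using this
  have hb2 : Function.Injective b.flip := by
    rw [injective_iff_map_eq_zero]
    rintro ⟨A, hAm⟩ h
    have : A = 0 := nondeg 𝒜 hA A hAm fun B hB => by
      have h2 : mpair B A = 0 := LinearMap.congr_fun h ⟨B, hB⟩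
      rw [← h2]
      simp only [mpair]
      rw [Finset.sum_comm]
      simp only [mul_comm]
    simpa using this
  have hp : b.IsPerfPair := LinearMap.IsPerfPair.of_injective hb1 hb2
  let res : MixT K d p q →ₗ[K] 𝒜.sub q p →ₗ[K] K :=
    (bpair K d p q).compl₁₂ LinearMap.id (𝒜.sub q p).subtype
  refine ⟨(𝒜.sub p q).subtype ∘ₗ b.toPerfPair.symm.toLinearMap ∘ₗ res, fun T => ?_,
    fun T B hB => ?_⟩
  · exact (b.toPerfPair.symm (res T)).2
  · have : b.toPerfPair (b.toPerfPair.symm (res T)) = res T := LinearEquiv.apply_symm_apply _ _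
    exact LinearMap.congr_fun this ⟨B, hB⟩

theorem proj_unique (𝒜 : SubProp K d) (hA : 𝒜.IsSimple) {p q : ℕ} {A A' : MixT K d p q}
    (h : A ∈ 𝒜.mem p q) (h' : A' ∈ 𝒜.mem p q)
    (h0 : ∀ B ∈ 𝒜.mem q p, mpair A B = mpair A' B) : A = A' := by
  rw [← sub_eq_zero]
  refine nondeg 𝒜 hA _ ((𝒜.sub p q).sub_mem h h') fun B hB => ?_
  have : mpair (A - A') B = mpair A B - mpair A' B := (bpair K d p q).map_sub₂ A A' B
  rw [this, h0 B hB, sub_self]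

end Pairing
section Poly
variable {K : Type} [Field K] {d : ℕ}

theorem perm_of_sum_single {α : Type} [DecidableEq α] {n : ℕ} (f g : Fin n → α)
    (h : ∀ s, (Finset.univ.filter fun a => f a = s).card =
      (Finset.univ.filter fun a => g a = s).card) : ∃ σ : Equiv.Perm (Fin n), f = g ∘ σ := by
  have e : ∀ s, Nonempty ({a // f a = s} ≃ {a // g a = s}) := fun s => by
    rw [← Fintype.card_eq, Fintype.card_subtype, Fintype.card_subtype, h s]
  replace e := fun s => (e s).some
  refine ⟨((Equiv.sigmaFiberEquiv f).symm.trans (Equiv.sigmaCongrRight e)).trans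
    (Equiv.sigmaFiberEquiv g), ?_⟩
  funext a
  exact (((e (f a)) ⟨a, rfl⟩).2).symm

/-- Index type of the polynomial variables. -/
abbrev PVar (d : ℕ) : Type := (Fin d × Fin d) ⊕ (Fin d × Fin d)

/-- The exponent of the monomial attached to two words. -/
noncomputable def mon {p q : ℕ} (z : Fin p → Fin d × Fin d) (w : Fin q → Fin d × Fin d) : PVar d →₀ ℕ :=
  ∑ a, Finsupp.single (Sum.inl (z a)) 1 + ∑ b, Finsupp.single (Sum.inr (w b)) 1

theorem mon_inl {p q : ℕ} (z : Fin p → Fin d × Fin d) (w : Fin q → Fin d × Fin d) (s) :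
    mon z w (Sum.inl s) = (Finset.univ.filter fun a => z a = s).card := by
  simp [mon, Finsupp.single_apply]

theorem mon_inr {p q : ℕ} (z : Fin p → Fin d × Fin d) (w : Fin q → Fin d × Fin d) (s) :
    mon z w (Sum.inr s) = (Finset.univ.filter fun a => w a = s).card := by
  simp [mon, Finsupp.single_apply]

theorem card_eq_sum_fiber {α : Type} [DecidableEq α] [Fintype α] {n : ℕ} (f : Fin n → α) :
    n = ∑ s, (Finset.univ.filter fun a => f a = s).card := by
  have := Finset.card_eq_sum_card_fiberwise (f := f) (s := Finset.univ) (t := Finset.univ)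
    (by simp)
  simpa using this

theorem mon_deg {p q p' q' : ℕ} (z : Fin p → Fin d × Fin d) (w : Fin q → Fin d × Fin d)
    (z' : Fin p' → Fin d × Fin d) (w' : Fin q' → Fin d × Fin d) (h : mon z w = mon z' w') :
    p = p' ∧ q = q' := by
  constructor
  · rw [card_eq_sum_fiber z, card_eq_sum_fiber z']
    exact Finset.sum_congr rfl fun s _ => by rw [← mon_inl _ w, h, mon_inl]
  · rw [card_eq_sum_fiber w, card_eq_sum_fiber w']
    exact Finset.sum_congr rfl fun s _ => by rw [← mon_inr z, h, mon_inr]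

theorem mon_perm {p q : ℕ} (z z' : Fin p → Fin d × Fin d) (w w' : Fin q → Fin d × Fin d)
    (h : mon z w = mon z' w') : ∃ (σ : Equiv.Perm (Fin p)) (τ : Equiv.Perm (Fin q)),
      z = z' ∘ σ ∧ w = w' ∘ τ := by
  obtain ⟨σ, hσ⟩ := perm_of_sum_single z z' (fun s => by rw [← mon_inl _ w, h, mon_inl])
  obtain ⟨τ, hτ⟩ := perm_of_sum_single w w' (fun s => by rw [← mon_inr z, h, mon_inr])
  exact ⟨σ, τ, hσ, hτ⟩

theorem mon_elim {p₁ q₁ p₂ q₂ p q : ℕ} (α : Fin p₁ ⊕ Fin p₂ ≃ Fin p)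
    (β : Fin q₁ ⊕ Fin q₂ ≃ Fin q) (z₁ : Fin p₁ → Fin d × Fin d) (z₂ : Fin p₂ → Fin d × Fin d)
    (w₁ : Fin q₁ → Fin d × Fin d) (w₂ : Fin q₂ → Fin d × Fin d) :
    mon (Sum.elim z₁ z₂ ∘ α.symm) (Sum.elim w₁ w₂ ∘ β.symm) = mon z₁ w₁ + mon z₂ w₂ := by
  simp only [mon]
  rw [← α.sum_comp, ← β.sum_comp]
  simp only [Function.comp_apply, Equiv.symm_apply_apply, Fintype.sum_sum_type, Sum.elim_inl,
    Sum.elim_inr]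
  abel

theorem mon_surj (m : PVar d →₀ ℕ) :
    ∃ (p q : ℕ) (z : Fin p → Fin d × Fin d) (w : Fin q → Fin d × Fin d), mon z w = m := by
  induction m using Finsupp.induction_linear with
  | zero => exact ⟨0, 0, Fin.elim0, Fin.elim0, by simp [mon]⟩
  | add f g hf hg =>
    obtain ⟨p, q, z, w, rfl⟩ := hf
    obtain ⟨p', q', z', w', rfl⟩ := hg
    exact ⟨_, _, _, _, mon_elim finSumFinEquiv finSumFinEquiv z z' w w'⟩
  | single s n =>
    rcases s with s | s
    · exact ⟨n, 0, fun _ => s, Fin.elim0, by simp [mon]⟩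
    · exact ⟨0, n, Fin.elim0, fun _ => s, by simp [mon]⟩

/-- Coordinates of the tensor moved by the generic pair of matrices. -/
noncomputable def gact {p q : ℕ} (A : MixT K d p q) (x' : Fin p → Fin d) (y' : Fin q → Fin d) :
    MvPolynomial (PVar d) K :=
  ∑ x : Fin p → Fin d, ∑ y : Fin q → Fin d,
    MvPolynomial.monomial (mon (fun a => (x a, x' a)) (fun b => (y b, y' b))) (A x y)

/-- Elementary tensor. -/
def elt (K : Type) [Field K] {d p q : ℕ} (x : Fin p → Fin d) (y : Fin q → Fin d) : MixT K d p q :=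
  fun s t => if s = x ∧ t = y then 1 else 0

theorem eq_sum_elt {p q : ℕ} (A : MixT K d p q) : A = ∑ x, ∑ y, A x y • elt K x y := by
  funext s t
  simp [elt, Finset.sum_apply, ite_and]

theorem gact_elt {p q : ℕ} (x x' : Fin p → Fin d) (y y' : Fin q → Fin d) :
    gact (elt K x y) x' y' =
      MvPolynomial.monomial (mon (fun a => (x a, x' a)) (fun b => (y b, y' b))) 1 := by
  simp only [gact, elt]
  rw [Finset.sum_eq_single x, Finset.sum_eq_single y]
  · simp
  · intro b _ hb; simp [hb]
  · simp
  · intro b _ hb; simp [hb]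
  · simp

theorem gact_glue {p₁ q₁ p₂ q₂ p q : ℕ} (α : Fin p₁ ⊕ Fin p₂ ≃ Fin p)
    (β : Fin q₁ ⊕ Fin q₂ ≃ Fin q) (A : MixT K d p₁ q₁) (T : MixT K d p₂ q₂) 
    (u : Fin p₁ → Fin d) (u' : Fin p₂ → Fin d) (v : Fin q₁ → Fin d) (v' : Fin q₂ → Fin d) :
    gact (glue α β A T) (Sum.elim u u' ∘ α.symm) (Sum.elim v v' ∘ β.symm) =
      gact A u v * gact T u' v' := by
  simp only [gact]
  rw [sum_split α]
  simp only [sum_split β]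
  simp only [Finset.sum_mul_sum]
  refine Finset.sum_congr rfl fun x1 _ => Finset.sum_congr rfl fun x2 _ =>
    Finset.sum_congr rfl fun y1 _ => Finset.sum_congr rfl fun y2 _ => ?_
  rw [MvPolynomial.monomial_mul, ← mon_elim α β]
  congr 1
  · congr 1
    congr 1
    · funext a
      obtain ⟨a, rfl⟩ := α.surjective a
      rcases a with a | a <;> simp
    · funext a
      obtain ⟨a, rfl⟩ := β.surjective a
      rcases a with a | a <;> simp
  · simp [glue]

/-- The functional on polynomials attached to a linear endomorphism of tensors. -/
noncomputable def theta {p q : ℕ} (L : MixT K d p q →ₗ[K] MixT K d p q) :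
    MvPolynomial (PVar d) K →ₗ[K] K :=
  open Classical in
  (MvPolynomial.basisMonomials (PVar d) K).constr K (fun m =>
    if h : ∃ zw : (Fin p → Fin d × Fin d) × (Fin q → Fin d × Fin d), mon zw.1 zw.2 = m then
      ∑ σ : Equiv.Perm (Fin p), ∑ τ : Equiv.Perm (Fin q),
        L (elt K (fun a => (h.choose.1 (σ a)).1) (fun a => (h.choose.2 (τ a)).1))
          (fun a => (h.choose.1 (σ a)).2) (fun a => (h.choose.2 (τ a)).2)
    else 0)

theorem theta_monomial {p q : ℕ} (L : MixT K d p q →ₗ[K] MixT K d p q)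
    (z : Fin p → Fin d × Fin d) (w : Fin q → Fin d × Fin d) (c : K) :
    theta L (MvPolynomial.monomial (mon z w) c) = c * 
      ∑ σ : Equiv.Perm (Fin p), ∑ τ : Equiv.Perm (Fin q),
        L (elt K (fun a => (z (σ a)).1) (fun a => (w (τ a)).1))
          (fun a => (z (σ a)).2) (fun a => (w (τ a)).2) := by
  have h1 : MvPolynomial.monomial (mon z w) c =
      c • MvPolynomial.basisMonomials (PVar d) K (mon z w) := by
    simp [MvPolynomial.smul_monomial]
  rw [h1, map_smul, theta, Module.Basis.constr_basis, smul_eq_mul]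
  have h : ∃ zw : (Fin p → Fin d × Fin d) × (Fin q → Fin d × Fin d),
    mon zw.1 zw.2 = mon z w := ⟨(z, w), rfl⟩
  rw [dif_pos h]
  congr 1
  obtain ⟨ρ, κ, h2, h3⟩ := mon_perm _ _ _ _ h.choose_spec
  rw [h2, h3]
  conv_rhs => rw [← Equiv.sum_comp (Equiv.mulLeft ρ)]
  refine Finset.sum_congr rfl fun σ _ => ?_
  conv_rhs => rw [← Equiv.sum_comp (Equiv.mulLeft κ)]
  rfl

theorem theta_monomial_ne {p q p' q' : ℕ} (L : MixT K d p q →ₗ[K] MixT K d p q)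
    (z : Fin p' → Fin d × Fin d) (w : Fin q' → Fin d × Fin d) (c : K) (hne : ¬ (p' = p ∧ q' = q)) :
    theta L (MvPolynomial.monomial (mon z w) c) = 0 := by
  have h1 : MvPolynomial.monomial (mon z w) c =
      c • MvPolynomial.basisMonomials (PVar d) K (mon z w) := by
    simp [MvPolynomial.smul_monomial]
  rw [h1, map_smul, theta, Module.Basis.constr_basis, smul_eq_mul, dif_neg, mul_zero]
  rintro ⟨⟨z', w'⟩, h⟩
  exact hne (mon_deg _ _ _ _ h.symm)

theorem theta_gact_ne {p q p' q' : ℕ} (L : MixT K d p q →ₗ[K] MixT K d p q)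
    (A : MixT K d p' q') (x' : Fin p' → Fin d) (y' : Fin q' → Fin d)
    (hne : ¬ (p' = p ∧ q' = q)) : theta L (gact A x' y') = 0 := by
  simp [gact, theta_monomial_ne L _ _ _ hne]

theorem theta_gact {p q : ℕ} (L : MixT K d p q →ₗ[K] MixT K d p q)
    (A : MixT K d p q) (x' : Fin p → Fin d) (y' : Fin q → Fin d) :
    theta L (gact A x' y') = ∑ σ : Equiv.Perm (Fin p), ∑ τ : Equiv.Perm (Fin q),
      L (fun s t => A (s ∘ σ.symm) (t ∘ τ.symm)) (x' ∘ σ) (y' ∘ τ) := by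
  have h : ∀ (σ : Equiv.Perm (Fin p)) (τ : Equiv.Perm (Fin q)),
      (fun s t => A (s ∘ σ.symm) (t ∘ τ.symm)) =
        ∑ x, ∑ y, A x y • elt K (x ∘ σ) (y ∘ τ) := by
    intro σ τ
    rw [eq_sum_elt (fun s t => A (s ∘ σ.symm) (t ∘ τ.symm)),
      ← (Equiv.arrowCongr σ.symm (Equiv.refl (Fin d))).sum_comp]
    refine Finset.sum_congr rfl fun x _ => ?_
    rw [← (Equiv.arrowCongr τ.symm (Equiv.refl (Fin d))).sum_comp]
    refine Finset.sum_congr rfl fun y _ => ?_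
    congr 2
    · funext a; simp
    · funext a; simp
  simp only [h, gact, map_sum, map_smul, theta_monomial, Finset.sum_apply, Pi.smul_apply,
    smul_eq_mul, Finset.mul_sum]
  rw [Finset.sum_congr rfl (fun x _ => Finset.sum_comm), Finset.sum_comm]
  refine Finset.sum_congr rfl fun σ _ => ?_
  rw [Finset.sum_congr rfl (fun x _ => Finset.sum_comm), Finset.sum_comm]
  rfl

end Poly
section Main
variable {K : Type} [Field K] [CharZero K] {d : ℕ}

theorem core (𝒜 ℬ : SubProp K d) (hA : 𝒜.IsSimple) (s : Set (MvPolynomial (PVar d) K))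
    (hs : ∀ h ∈ s, ∃ (p q : ℕ) (A : MixT K d p q) (x' : Fin p → Fin d) (y' : Fin q → Fin d),
      0 < p + q ∧ A ∈ 𝒜.mem p q ∧ A ∈ ℬ.mem p q ∧ h = gact A x' y')
    (hspan : ∀ (p q : ℕ) (A : MixT K d p q) (x' : Fin p → Fin d) (y' : Fin q → Fin d),
      0 < p + q → A ∈ 𝒜.mem p q → gact A x' y' ∈ Ideal.span s) (n : ℕ) :
    ∀ p q : ℕ, p + q = n → 𝒜.mem p q ⊆ ℬ.mem p q := by
  choose π hπ1 hπ2 using exists_proj 𝒜 hA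
  have hπid : ∀ (p q : ℕ) (A : MixT K d p q), A ∈ 𝒜.mem p q → π p q A = A := fun p q A h =>
    proj_unique 𝒜 hA (hπ1 _ _ _) h (hπ2 _ _ _)
  have hπg : ∀ {p₁ q₁ p₂ q₂ p q : ℕ} (α : Fin p₁ ⊕ Fin p₂ ≃ Fin p)
      (β : Fin q₁ ⊕ Fin q₂ ≃ Fin q) (A : MixT K d p₁ q₁) (T : MixT K d p₂ q₂),
      A ∈ 𝒜.mem p₁ q₁ → π p q (glue α β A T) = glue α β A (π p₂ q₂ T) := by
    intro p₁ q₁ p₂ q₂ p q α β A T h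
    refine proj_unique 𝒜 hA (hπ1 _ _ _) (glue_mem 𝒜 α β h (hπ1 _ _ _)) fun B hB => ?_
    rw [hπ2 _ _ _ B hB]
    obtain ⟨B', hB', h⟩ := glue_pair 𝒜 α β h hB
    rw [h, h, hπ2 _ _ _ B' hB']
  induction n using Nat.strong_induction_on with
  | _ n ih =>
  intro p q hpq A hAm
  rcases Nat.eq_zero_or_pos n with h0 | hpos
  · obtain ⟨rfl, rfl⟩ : p = 0 ∧ q = 0 := by omega
    have : A = A default default • munit K d := by
      funext x y
      simp only [munit, Pi.smul_apply, smul_eq_mul, mul_one]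
      congr 1 <;> exact Subsingleton.elim _ _
    rw [this]
    exact ℬ.smul_mem _ _ _ _ ℬ.unit_mem
  obtain ⟨W, hW⟩ := Submodule.exists_isCompl (ℬ.sub p q)
  let Q : MixT K d p q →ₗ[K] MixT K d p q := W.subtype ∘ₗ W.projectionOnto _ hW.symm
  have hQ0 : ∀ b ∈ ℬ.mem p q, Q b = 0 := by
    intro b hb
    have := (Submodule.projectionOnto_apply_eq_zero_iff hW.symm (x := b)).mpr hb
    simp [Q, this]
  have hQ1 : ∀ v, v - Q v ∈ ℬ.mem p q := by
    intro v
    have : W.projectionOnto _ hW.symm (v - Q v) = 0 := by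
      have h2 : W.projectionOnto _ hW.symm (Q v) = W.projectionOnto _ hW.symm v :=
        Submodule.projectionOnto_apply_left hW.symm (W.projectionOnto _ hW.symm v)
      rw [map_sub, h2, sub_self]
    exact (Submodule.projectionOnto_apply_eq_zero_iff hW.symm).mp this
  let L := Q ∘ₗ π p q
  have key : ∀ r ∈ Ideal.span s, ∀ h : MvPolynomial (PVar d) K, theta L (h * r) = 0 := by
    intro r hr
    induction hr using Submodule.span_induction with
    | zero => intro h; simp
    | add a b _ _ ha hb => intro h; rw [mul_add, map_add, ha, hb, add_zero]
    | smul a b _ hb => intro h; rw [smul_eq_mul, ← mul_assoc]; exact hb _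
    | mem r hr =>
      obtain ⟨p₁, q₁, A₁, u, v, hpos1, hA1, hB1, rfl⟩ := hs r hr
      intro h
      induction h using MvPolynomial.induction_on' with
      | add f g hf hg => rw [add_mul, map_add, hf, hg, add_zero]
      | monomial m c =>
        obtain ⟨p₂, q₂, z, w, rfl⟩ := mon_surj m
        have h1 : MvPolynomial.monomial (mon z w) c * gact A₁ u v = c •
            gact (glue finSumFinEquiv finSumFinEquiv A₁ (elt K (fun a => (z a).1)
              (fun a => (w a).1))) (Sum.elim u (fun a => (z a).2) ∘ finSumFinEquiv.symm)
              (Sum.elim v (fun a => (w a).2) ∘ finSumFinEquiv.symm) := by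
          rw [gact_glue, gact_elt, mul_comm (gact A₁ u v), ← smul_mul_assoc,
            MvPolynomial.smul_monomial, smul_eq_mul, mul_one]
        rw [h1, map_smul]
        by_cases hd : p₁ + p₂ = p ∧ q₁ + q₂ = q
        · obtain ⟨rfl, rfl⟩ := hd
          rw [theta_gact]
          refine (congrArg (c • ·) (Finset.sum_eq_zero fun σ _ =>
            Finset.sum_eq_zero fun τ _ => ?_)).trans (smul_zero c)
          have h2 : L (glue (finSumFinEquiv.trans σ.symm) (finSumFinEquiv.trans τ.symm) A₁
              (elt K (fun a => (z a).1) (fun a => (w a).1))) = 0 := by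
            change Q (π _ _ _) = 0
            rw [hπg _ _ _ _ hA1]
            refine hQ0 _ (glue_mem ℬ _ _ hB1 ?_)
            exact ih (p₂ + q₂) (by omega) _ _ rfl (hπ1 _ _ _)
          exact congrFun (congrFun h2 _) _
        · rw [theta_gact_ne L _ _ _ hd, smul_zero]
  have fin : ∀ x' y', ∑ σ : Equiv.Perm (Fin p), ∑ τ : Equiv.Perm (Fin q),
      Q (fun s t => A (s ∘ σ.symm) (t ∘ τ.symm)) (x' ∘ σ) (y' ∘ τ) = 0 := by
    intro x' y'
    have h1 := key _ (hspan p q A x' y' (by omega) hAm) 1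
    rw [one_mul, theta_gact] at h1
    rw [← h1]
    refine Finset.sum_congr rfl fun σ _ => Finset.sum_congr rfl fun τ _ => ?_
    change _ = Q (π _ _ _) _ _
    rw [hπid _ _ _ (𝒜.perm_mem σ.symm τ.symm A hAm)]
  let b : Equiv.Perm (Fin p) → Equiv.Perm (Fin q) → MixT K d p q := fun σ τ =>
    (fun s t => A (s ∘ σ.symm) (t ∘ τ.symm)) - Q (fun s t => A (s ∘ σ.symm) (t ∘ τ.symm))
  have hb : ∑ σ : Equiv.Perm (Fin p), ∑ τ : Equiv.Perm (Fin q),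
      (fun x y => b σ τ (x ∘ σ) (y ∘ τ) : MixT K d p q) ∈ ℬ.sub p q :=
    Submodule.sum_mem _ fun σ _ => Submodule.sum_mem _ fun τ _ =>
      ℬ.perm_mem σ τ _ (hQ1 _)
  have hsum : ∑ σ : Equiv.Perm (Fin p), ∑ τ : Equiv.Perm (Fin q),
      (fun x y => b σ τ (x ∘ σ) (y ∘ τ) : MixT K d p q) =
      ((p.factorial * q.factorial : ℕ) : K) • A := by
    funext x y
    simp only [Finset.sum_apply, b, Pi.sub_apply, Finset.sum_sub_distrib, fin, sub_zero,
      Function.comp_assoc, Equiv.self_comp_symm, Function.comp_id]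
    simp [Fintype.card_perm, mul_assoc]
  rw [hsum] at hb
  exact ((ℬ.sub p q).smul_mem_iff (by
    exact_mod_cast (Nat.mul_pos p.factorial_pos q.factorial_pos).ne')).mp hb

end Main

theorem stmt14 (K : Type) [Field K] [CharZero K] [IsAlgClosed K] (d : ℕ)
    (𝒜 : SubProp K d) (hA : 𝒜.IsSimple) :
    ∃ (m : ℕ) (gens : Fin m → Σ p : ℕ, Σ q : ℕ, MixT K d p q),
      (∀ k : Fin m, (gens k).2.2 ∈ 𝒜.mem (gens k).1 (gens k).2.1) ∧
      (∀ ℬ : SubProp K d,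
        (∀ k : Fin m, (gens k).2.2 ∈ ℬ.mem (gens k).1 (gens k).2.1) →
        ∀ p q : ℕ, 𝒜.mem p q ⊆ ℬ.mem p q) := by
  let S : Set (MvPolynomial (PVar d) K) := {h | ∃ (p q : ℕ) (A : MixT K d p q)
    (x' : Fin p → Fin d) (y' : Fin q → Fin d), 0 < p + q ∧ A ∈ 𝒜.mem p q ∧ h = gact A x' y'}
  obtain ⟨s, hsS, hspan⟩ := (Submodule.fg_span_iff_fg_span_finset_subset S).mp
    (IsNoetherian.noetherian (Ideal.span S))
  have hdata : ∀ h : s, ∃ g : Σ p : ℕ, Σ q : ℕ, MixT K d p q, g.2.2 ∈ 𝒜.mem g.1 g.2.1 ∧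
      0 < g.1 + g.2.1 ∧ ∃ x' y', (h : MvPolynomial (PVar d) K) = gact g.2.2 x' y' := by
    rintro ⟨h, hh⟩
    obtain ⟨p, q, A, x', y', h0, hAm, he⟩ := hsS hh
    exact ⟨⟨p, q, A⟩, hAm, h0, x', y', he⟩
  choose g hg1 hg2 hg3 using hdata
  refine ⟨s.card, fun k => g (s.equivFin.symm k), fun k => hg1 _, fun ℬ hℬ p q => ?_⟩
  refine core 𝒜 ℬ hA (s : Set (MvPolynomial (PVar d) K)) ?_ ?_ (p + q) p q rfl
  · intro h hh
    obtain ⟨x', y', he⟩ := hg3 ⟨h, hh⟩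
    refine ⟨_, _, _, x', y', hg2 ⟨h, hh⟩, hg1 _, ?_, he⟩
    have := hℬ (s.equivFin ⟨h, hh⟩)
    have he : s.equivFin.symm (s.equivFin ⟨h, hh⟩) = ⟨h, hh⟩ := Equiv.symm_apply_apply _ _
    exact Eq.mp (congrArg (fun k => (g k).2.2 ∈ ℬ.mem (g k).1 (g k).2.1) he) this
  · intro p q A x' y' h0 hAm
    have : gact A x' y' ∈ Ideal.span S :=
      Ideal.subset_span ⟨p, q, A, x', y', h0, hAm, rfl⟩
    rw [Ideal.span, hspan] at this
    exact this
end

section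
/- Let K be a field of characteristic 0 and let (R, Tr) be a K-algebra with trace satisfying the n-th Cayley–Hamilton identity. Then there exist a commutative K-algebra S and an injective K-algebra homomorphism ρ : R → Mat_n(S) that is trace-preserving, i.e., ρ(Tr(a)) = tr(ρ(a))·I_n for all a ∈ R. -/
/-- A trace structure on an associative unital `K`-algebra `R`: a `K`-linear map
`Tr : R → R` with `Tr(a)·b = b·Tr(a)`, `Tr(ab) = Tr(ba)` and
`Tr(Tr(a)·b) = Tr(a)·Tr(b)`. -/
structure TraceData (K R : Type) [CommRing K] [Ring R] [Algebra K R] where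
  Tr : R →ₗ[K] R
  central : ∀ a b : R, Tr a * b = b * Tr a
  trace_mul_comm : ∀ a b : R, Tr (a * b) = Tr (b * a)
  trace_trace : ∀ a b : R, Tr (Tr a * b) = Tr a * Tr b

/-- The "elementary symmetric functions" `σ_k(a)` of an element of a trace algebra:
`σ_0(a) = 1` and `σ_k(a) = (1/k)·Σ_{i=1}^{k} (−1)^{i−1} σ_{k−i}(a)·Tr(a^i)`. -/
noncomputable def traceSigma {K R : Type} [Field K] [CharZero K] [Ring R] [Algebra K R]
    (D : TraceData K R) (a : R) : ℕ → R
  | 0 => 1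
  | (k + 1) =>
      (((k : K) + 1)⁻¹) • ∑ i ∈ Finset.range (k + 1),
        (-1 : R) ^ i * traceSigma D a (k - i) * D.Tr (a ^ (i + 1))
  decreasing_by exact Nat.lt_succ_of_le (Nat.sub_le k i)

/-- `R` satisfies the `n`-th Cayley–Hamilton identity: `Tr(1) = n` and
`Σ_{k=0}^{n} (−1)^k σ_k(a) a^{n−k} = 0` for all `a ∈ R`. -/
def IsCayleyHamilton {K R : Type} [Field K] [CharZero K] [Ring R] [Algebra K R]
    (D : TraceData K R) (n : ℕ) : Prop :=
  D.Tr 1 = (n : R) ∧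
  ∀ a : R, ∑ k ∈ Finset.range (n + 1),
    (-1 : R) ^ k * traceSigma D a k * a ^ (n - k) = 0


namespace CHProof
open Equiv Equiv.Perm

set_option linter.unusedSimpArgs false
set_option linter.unusedVariables false
set_option linter.unusedSectionVars false

section TDef
variable {W C : Type} [Monoid W] [Ring C]

/-- insert the letter `0` before the letter `p` -/
def ins {m : ℕ} (p : Fin (m+1)) (τ : Perm (Fin m)) : Perm (Fin (m+1)) := decomposeFin.symm (p, τ)

lemma ins_zero {m : ℕ} (p : Fin (m+1)) (τ : Perm (Fin m)) : ins p τ 0 = p := by simp [ins]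

lemma ins_succ {m : ℕ} (p : Fin (m+1)) (τ : Perm (Fin m)) (x : Fin m) :
    ins p τ x.succ = if (τ x).succ = p then 0 else (τ x).succ := by
  simp only [ins, decomposeFin_symm_apply_succ, swap_apply_def]
  simp

lemma ins_mul {m : ℕ} (p : Fin (m+1)) (τ ρ : Perm (Fin m)) : ins p τ * ins 0 ρ = ins p (τ * ρ) := by
  ext x
  refine Fin.cases ?_ (fun x => ?_) x
  · simp [ins_zero]
  · simp only [Perm.mul_apply, ins_succ, Fin.succ_ne_zero, if_false]
    congr

lemma exists_ins {m : ℕ} (σ : Perm (Fin (m+1))) : ∃ p τ, σ = ins p τ :=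
  ⟨(decomposeFin σ).1, (decomposeFin σ).2, by simp [ins]⟩

lemma ins_inj {m : ℕ} {p q : Fin (m+1)} {τ ρ : Perm (Fin m)} : ins p τ = ins q ρ ↔ p = q ∧ τ = ρ := by
  simp [ins]

lemma sign_ins {m : ℕ} (p : Fin (m+1)) (τ : Perm (Fin m)) :
    Perm.sign (ins p τ) = ite (p = 0) 1 (-1) * Perm.sign τ := by simp [ins]

lemma sum_ins {m : ℕ} {A : Type*} [AddCommMonoid A] (f : Perm (Fin (m+1)) → A) :
    ∑ σ, f σ = ∑ p, ∑ τ, f (ins p τ) := by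
  rw [← Fintype.sum_prod_type', ← Equiv.sum_comp decomposeFin.symm]
  rfl

/-- Product of traces of the cycle words. -/
def T (t : W → C) : (m : ℕ) → (Fin m → W) → Perm (Fin m) → C
  | 0, _, _ => 1
  | m+1, w, σ =>
    Fin.cases (motive := fun _ => C) (t (w 0) * T t m (Fin.tail w) (decomposeFin σ).2)
      (fun k => T t m (Function.update (Fin.tail w) k (w 0 * w k.succ)) (decomposeFin σ).2)
      (decomposeFin σ).1

variable (t : W → C)

lemma T_ins_zero {m : ℕ} (w : Fin (m+1) → W) (τ : Perm (Fin m)) :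
    T t (m+1) w (ins 0 τ) = t (w 0) * T t m (Fin.tail w) τ := by
  simp [T, ins]

lemma T_ins_succ {m : ℕ} (w : Fin (m+1) → W) (k : Fin m) (τ : Perm (Fin m)) :
    T t (m+1) w (ins k.succ τ) = T t m (Function.update (Fin.tail w) k (w 0 * w k.succ)) τ := by
  simp [T, ins]

variable (ht : ∀ x y, t (x * y) = t (y * x)) (hc : ∀ x y, t x * t y = t y * t x)

def ConjOK (t : W → C) (m : ℕ) (π : Perm (Fin m)) : Prop :=
  ∀ w σ, T t m (w ∘ π) (π⁻¹ * σ * π) = T t m w σ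

lemma ConjOK.mul {m : ℕ} {π ρ : Perm (Fin m)} (h1 : ConjOK t m π) (h2 : ConjOK t m ρ) :
    ConjOK t m (π * ρ) := by
  intro w σ
  rw [← h1 w σ, ← h2 (w ∘ π)]
  congr 1

lemma ConjOK.inner {m : ℕ} {π : Perm (Fin m)} (h : ConjOK t m π) : ConjOK t (m+1) (ins 0 π) := by
  intro w σ
  obtain ⟨p, τ, rfl⟩ := exists_ins σ
  have hinv : (ins 0 π)⁻¹ = ins 0 π⁻¹ := by
    rw [inv_eq_iff_mul_eq_one, ins_mul, mul_inv_cancel]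
    simp [ins]
    rfl
  have htail : Fin.tail (w ∘ ins 0 π) = Fin.tail w ∘ π := by
    ext x; simp [Fin.tail, ins_succ]
  refine Fin.cases ?_ (fun k => ?_) p
  · rw [hinv, ins_mul, ins_mul, T_ins_zero, T_ins_zero, htail, h]
    simp [ins_zero]
  · have : (ins 0 π)⁻¹ * ins k.succ τ * ins 0 π = ins (π⁻¹ k).succ (π⁻¹ * τ * π) := by
      rw [hinv]
      ext x
      refine Fin.cases ?_ (fun x => ?_) x
      · simp [ins_zero, ins_succ]
      · simp only [Perm.mul_apply, ins_succ, Fin.succ_ne_zero, if_false, Fin.succ_inj, EmbeddingLike.apply_eq_iff_eq]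
        split_ifs
        · simp [ins_zero]
        · simp [ins_succ]
    rw [this, T_ins_succ, T_ins_succ, htail, ← h _ τ]
    congr 1
    ext x
    simp only [Function.comp, Function.update_apply, ins_zero, ins_succ]
    by_cases hx : x = π⁻¹ k
    · subst hx; simp
    · rw [if_neg hx, if_neg]
      rintro rfl; simp at hx

include ht hc in
lemma conjOK_swap {m : ℕ} : ConjOK t (m+2) (swap 0 1) := by
  intro w σ
  obtain ⟨p, σ', rfl⟩ := exists_ins σ
  obtain ⟨q, τ, rfl⟩ := exists_ins σ'
  have h10 : (1 : Fin (m+2)) = Fin.succ 0 := rfl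
  rw [h10]
  have hs : ∀ k : Fin m, swap (0 : Fin (m+2)) (Fin.succ 0) k.succ.succ = k.succ.succ := fun k =>
    swap_apply_of_ne_of_ne (Fin.succ_ne_zero _) (fun h => Fin.succ_ne_zero _ (Fin.succ_injective _ h))
  have hs0 : swap (0 : Fin (m+2)) (Fin.succ 0) 0 = Fin.succ 0 := swap_apply_left _ _
  have hs1 : swap (0 : Fin (m+2)) (Fin.succ 0) (Fin.succ 0) = 0 := swap_apply_right _ _
  have ev : ∀ p' q', swap (0 : Fin (m+2)) (Fin.succ 0) (ins p (ins q τ) (Fin.succ 0)) = p' →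
     swap (0 : Fin (m+2)) (Fin.succ 0) p = ins p' (ins q' τ) (Fin.succ 0) →
     (∀ x : Fin m, swap (0 : Fin (m+2)) (Fin.succ 0) (ins p (ins q τ) x.succ.succ)
        = ins p' (ins q' τ) x.succ.succ) →
     (swap (0 : Fin (m+2)) (Fin.succ 0))⁻¹ * ins p (ins q τ) * swap 0 (Fin.succ 0)
        = ins p' (ins q' τ) := by
    intro p' q' h1 h2 h3
    apply Equiv.ext
    intro x
    rw [swap_inv, Perm.mul_apply, Perm.mul_apply]
    refine Fin.cases ?_ (fun x => ?_) x
    · rw [hs0, h1, ins_zero]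
    · refine Fin.cases ?_ (fun x => ?_) x
      · rw [hs1, ins_zero, h2]
      · rw [hs, h3]
  have hsw : ∀ x : Fin m, w (swap 0 (Fin.succ 0) x.succ.succ) = w x.succ.succ := fun x => by rw [hs]
  obtain rfl | ⟨p, rfl⟩ := Fin.eq_zero_or_eq_succ p
  · obtain rfl | ⟨k, rfl⟩ := Fin.eq_zero_or_eq_succ q
    · rw [ev (0) (0) (by simp [-Fin.succ_zero_eq_one, -Fin.succ_zero_eq_one', ins_zero, ins_succ, hs, hs0, hs1, Fin.succ_ne_zero, (Fin.succ_ne_zero _).symm]) (by simp [-Fin.succ_zero_eq_one, -Fin.succ_zero_eq_one', ins_zero, ins_succ, hs, hs0, hs1, Fin.succ_ne_zero, (Fin.succ_ne_zero _).symm]) ?_]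
      · simp only [T_ins_zero, T_ins_succ]
        rw [← mul_assoc, ← mul_assoc, hc]
        refine congrArg₂ (· * ·) (congrArg₂ (· * ·) (congrArg t ?_) (congrArg t ?_)) (congrArg (T t m · τ) (funext fun x => ?_))
        · simp [-Fin.succ_zero_eq_one, -Fin.succ_zero_eq_one', Function.update_apply, Fin.tail, hs, hs0, hs1, Fin.succ_ne_zero, (Fin.succ_ne_zero _).symm, mul_assoc]
        · simp [-Fin.succ_zero_eq_one, -Fin.succ_zero_eq_one', Function.update_apply, Fin.tail, hs, hs0, hs1, Fin.succ_ne_zero, (Fin.succ_ne_zero _).symm, mul_assoc]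
        · simp [-Fin.succ_zero_eq_one, -Fin.succ_zero_eq_one', Function.update_apply, Fin.tail, hs, hs0, hs1, Fin.succ_ne_zero, (Fin.succ_ne_zero _).symm, mul_assoc]
      · intro x
        simp only [ins_zero, ins_succ, Fin.succ_inj, Fin.succ_ne_zero, (Fin.succ_ne_zero _).symm, if_false, if_true, apply_ite Fin.succ]
        clear ev
        grind
    · rw [ev (k.succ.succ) (0) (by simp [-Fin.succ_zero_eq_one, -Fin.succ_zero_eq_one', ins_zero, ins_succ, hs, hs0, hs1, Fin.succ_ne_zero, (Fin.succ_ne_zero _).symm]) (by simp [-Fin.succ_zero_eq_one, -Fin.succ_zero_eq_one', ins_zero, ins_succ, hs, hs0, hs1, Fin.succ_ne_zero, (Fin.succ_ne_zero _).symm]) ?_]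
      · simp only [T_ins_zero, T_ins_succ]
        refine congrArg₂ (· * ·) (congrArg t ?_) (congrArg (T t m · τ) (funext fun x => ?_))
        · simp [-Fin.succ_zero_eq_one, -Fin.succ_zero_eq_one', Function.update_apply, Fin.tail, hs, hs0, hs1, Fin.succ_ne_zero, (Fin.succ_ne_zero _).symm, mul_assoc]
        · simp [-Fin.succ_zero_eq_one, -Fin.succ_zero_eq_one', Function.update_apply, Fin.tail, hs, hs0, hs1, Fin.succ_ne_zero, (Fin.succ_ne_zero _).symm, mul_assoc]
      · intro x
        simp only [ins_zero, ins_succ, Fin.succ_inj, Fin.succ_ne_zero, (Fin.succ_ne_zero _).symm, if_false, if_true, apply_ite Fin.succ]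
        clear ev
        grind
  · obtain rfl | ⟨k, rfl⟩ := Fin.eq_zero_or_eq_succ p
    · obtain rfl | ⟨k, rfl⟩ := Fin.eq_zero_or_eq_succ q
      · rw [ev (Fin.succ 0) (0) (by simp [-Fin.succ_zero_eq_one, -Fin.succ_zero_eq_one', ins_zero, ins_succ, hs, hs0, hs1, Fin.succ_ne_zero, (Fin.succ_ne_zero _).symm]) (by simp [-Fin.succ_zero_eq_one, -Fin.succ_zero_eq_one', ins_zero, ins_succ, hs, hs0, hs1, Fin.succ_ne_zero, (Fin.succ_ne_zero _).symm]) ?_]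
        · simp only [T_ins_zero, T_ins_succ]
          rw [Function.update_self, Function.update_self, ht]
          refine congrArg₂ (· * ·) (congrArg t ?_) (congrArg (T t m · τ) (funext fun x => ?_))
          · simp [-Fin.succ_zero_eq_one, -Fin.succ_zero_eq_one', Function.update_apply, Fin.tail, hs, hs0, hs1, Fin.succ_ne_zero, (Fin.succ_ne_zero _).symm, mul_assoc]
          · simp [-Fin.succ_zero_eq_one, -Fin.succ_zero_eq_one', Function.update_apply, Fin.tail, hs, hs0, hs1, Fin.succ_ne_zero, (Fin.succ_ne_zero _).symm, mul_assoc]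
        · intro x
          simp only [ins_zero, ins_succ, Fin.succ_inj, Fin.succ_ne_zero, (Fin.succ_ne_zero _).symm, if_false, if_true, apply_ite Fin.succ]
          clear ev
          grind
      · rw [ev (k.succ.succ) (k.succ) (by simp [-Fin.succ_zero_eq_one, -Fin.succ_zero_eq_one', ins_zero, ins_succ, hs, hs0, hs1, Fin.succ_ne_zero, (Fin.succ_ne_zero _).symm]) (by simp [-Fin.succ_zero_eq_one, -Fin.succ_zero_eq_one', ins_zero, ins_succ, hs, hs0, hs1, Fin.succ_ne_zero, (Fin.succ_ne_zero _).symm]) ?_]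
        · simp only [T_ins_zero, T_ins_succ]
          refine congrArg (T t m · τ) (funext fun x => ?_)
          simp [-Fin.succ_zero_eq_one, -Fin.succ_zero_eq_one', Function.update_apply, Fin.tail, hs, hs0, hs1, Fin.succ_ne_zero, (Fin.succ_ne_zero _).symm, mul_assoc]
          clear ev; grind
        · intro x
          simp only [ins_zero, ins_succ, Fin.succ_inj, Fin.succ_ne_zero, (Fin.succ_ne_zero _).symm, if_false, if_true, apply_ite Fin.succ]
          clear ev
          grind
    · obtain rfl | ⟨l, rfl⟩ := Fin.eq_zero_or_eq_succ q
      · rw [ev (0) (k.succ) (by simp [-Fin.succ_zero_eq_one, -Fin.succ_zero_eq_one', ins_zero, ins_succ, hs, hs0, hs1, Fin.succ_ne_zero, (Fin.succ_ne_zero _).symm]) (by simp [-Fin.succ_zero_eq_one, -Fin.succ_zero_eq_one', ins_zero, ins_succ, hs, hs0, hs1, Fin.succ_ne_zero, (Fin.succ_ne_zero _).symm]) ?_]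
        · simp only [T_ins_zero, T_ins_succ]
          refine congrArg₂ (· * ·) (congrArg t ?_) (congrArg (T t m · τ) (funext fun x => ?_))
          · simp [-Fin.succ_zero_eq_one, -Fin.succ_zero_eq_one', Function.update_apply, Fin.tail, hs, hs0, hs1, Fin.succ_ne_zero, (Fin.succ_ne_zero _).symm, mul_assoc]
          · simp [-Fin.succ_zero_eq_one, -Fin.succ_zero_eq_one', Function.update_apply, Fin.tail, hs, hs0, hs1, Fin.succ_ne_zero, (Fin.succ_ne_zero _).symm, mul_assoc]
        · intro x
          simp only [ins_zero, ins_succ, Fin.succ_inj, Fin.succ_ne_zero, (Fin.succ_ne_zero _).symm, if_false, if_true, apply_ite Fin.succ]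
          clear ev
          grind
      · by_cases hkl : k = l
        · subst hkl
          rw [ev (Fin.succ 0) (k.succ) (by simp [-Fin.succ_zero_eq_one, -Fin.succ_zero_eq_one', ins_zero, ins_succ, hs, hs0, hs1, Fin.succ_ne_zero, (Fin.succ_ne_zero _).symm]) (by simp [-Fin.succ_zero_eq_one, -Fin.succ_zero_eq_one', ins_zero, ins_succ, hs, hs0, hs1, Fin.succ_ne_zero, (Fin.succ_ne_zero _).symm]) ?_]
          · simp only [T_ins_zero, T_ins_succ]
            refine congrArg (T t m · τ) (funext fun x => ?_)
            simp [-Fin.succ_zero_eq_one, -Fin.succ_zero_eq_one', Function.update_apply, Fin.tail, hs, hs0, hs1, Fin.succ_ne_zero, (Fin.succ_ne_zero _).symm, mul_assoc]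
            clear ev; grind
          · intro x
            simp only [ins_zero, ins_succ, Fin.succ_inj, Fin.succ_ne_zero, (Fin.succ_ne_zero _).symm, if_false, if_true, apply_ite Fin.succ]
            clear ev
            grind
        · rw [ev (l.succ.succ) (k.succ) (by simp [-Fin.succ_zero_eq_one, -Fin.succ_zero_eq_one', ins_zero, ins_succ, hs, hs0, hs1, Fin.succ_ne_zero, (Fin.succ_ne_zero _).symm, hkl, Ne.symm hkl]) (by simp [-Fin.succ_zero_eq_one, -Fin.succ_zero_eq_one', ins_zero, ins_succ, hs, hs0, hs1, Fin.succ_ne_zero, (Fin.succ_ne_zero _).symm, hkl, Ne.symm hkl]) ?_]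
          · simp only [T_ins_zero, T_ins_succ]
            refine congrArg (T t m · τ) (funext fun x => ?_)
            simp [-Fin.succ_zero_eq_one, -Fin.succ_zero_eq_one', Function.update_apply, Fin.tail, hs, hs0, hs1, Fin.succ_ne_zero, (Fin.succ_ne_zero _).symm, mul_assoc, hkl, Ne.symm hkl]
            try grind
          · intro x
            simp only [ins_zero, ins_succ, Fin.succ_inj, Fin.succ_ne_zero, (Fin.succ_ne_zero _).symm, if_false, if_true, apply_ite Fin.succ]
            clear ev
            grind

include ht hc in
lemma conjOK_all : ∀ {m : ℕ} (π : Perm (Fin m)), ConjOK t m π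
  | 0, π => fun w σ => by
      have : π = 1 := Subsingleton.elim _ _
      subst this; simp
  | 1, π => fun w σ => by
      have : π = 1 := Subsingleton.elim _ _
      subst this; simp
  | m+2, π => by
      obtain ⟨p, τ, rfl⟩ := exists_ins π
      have h1 : ConjOK t (m+2) (ins 0 τ) := ConjOK.inner t (conjOK_all τ)
      have hsw : ∀ p : Fin (m+2), ConjOK t (m+2) (Equiv.swap 0 p) := by
        intro p
        obtain rfl | ⟨k, rfl⟩ := Fin.eq_zero_or_eq_succ p
        · have h0 : Equiv.swap (0 : Fin (m+2)) 0 = 1 := Equiv.swap_self _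
          rw [h0]
          intro w σ; simp
        · have e : Equiv.swap 0 k.succ =
              ins 0 (Equiv.swap 0 k) * Equiv.swap (0 : Fin (m+2)) 1 * ins 0 (Equiv.swap 0 k) := by
            have h2 : (ins 0 (Equiv.swap 0 k))⁻¹ = ins 0 (Equiv.swap 0 k) := by
              rw [inv_eq_iff_mul_eq_one, ins_mul, swap_mul_self]
              simp [ins]
              rfl
            nth_rewrite 2 [← h2]
            have h3 := Equiv.swap_apply_apply (ins 0 (Equiv.swap 0 k)) (0 : Fin (m+2)) (Fin.succ 0)
            rw [← Fin.succ_zero_eq_one, ← h3, ins_zero, ins_succ]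
            simp
          rw [e]
          have h4 : ConjOK t (m+2) (ins 0 (Equiv.swap 0 k)) := ConjOK.inner t (conjOK_all _)
          exact ((h4.mul t (conjOK_swap t ht hc)).mul t h4)
      have e : ins p τ = Equiv.swap 0 p * ins 0 τ := by
        have : Equiv.swap 0 p = ins p 1 := by simp [ins]
        rw [this, ins_mul, one_mul]
      rw [e]
      exact (hsw p).mul t h1

include ht hc in
lemma T_conj {m : ℕ} (π : Perm (Fin m)) (w : Fin m → W) (σ : Perm (Fin m)) :
    T t m (w ∘ π) (π⁻¹ * σ * π) = T t m w σ := conjOK_all t ht hc π w σ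

/-- linearity in a slot -/
lemma T_lin (c d : C) (hcc : ∀ x, Commute c (t x)) (hdd : ∀ x, Commute d (t x)) :
    ∀ {m : ℕ} (w : Fin m → W) (k : Fin m) (x y z : W)
    (h : ∀ u v, t (u * x * v) = c * t (u * y * v) + d * t (u * z * v)) (σ : Perm (Fin m)),
    T t m (Function.update w k x) σ = c * T t m (Function.update w k y) σ
      + d * T t m (Function.update w k z) σ
  | 0, _, k, _, _, _, _, _ => k.elim0
  | m+1, w, k, x, y, z, h, σ => by
      obtain ⟨p, τ, rfl⟩ := exists_ins σ
      have tail0 : ∀ x, Fin.tail (Function.update w 0 x) = Fin.tail w := by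
        intro x; ext i; simp [Fin.tail]
      have tails : ∀ (k : Fin m) x, Fin.tail (Function.update w k.succ x)
          = Function.update (Fin.tail w) k x := by
        intro k x; ext i; simp [Fin.tail, Function.update_apply]
      obtain rfl | ⟨p, rfl⟩ := Fin.eq_zero_or_eq_succ p
      · obtain rfl | ⟨k, rfl⟩ := Fin.eq_zero_or_eq_succ k
        · simp only [T_ins_zero, tail0, Function.update_self]
          have := h 1 1
          simp only [one_mul, mul_one] at this
          rw [this]; simp only [add_mul, mul_assoc]
        · simp only [T_ins_zero, tails]
          rw [T_lin c d hcc hdd (Fin.tail w) k x y z h τ]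
          rw [Function.update_of_ne (Fin.succ_ne_zero k).symm,
            Function.update_of_ne (Fin.succ_ne_zero k).symm,
            Function.update_of_ne (Fin.succ_ne_zero k).symm]
          rw [mul_add, ← mul_assoc, ← mul_assoc, ← (hcc _).eq, ← (hdd _).eq, mul_assoc, mul_assoc]
      · obtain rfl | ⟨k, rfl⟩ := Fin.eq_zero_or_eq_succ k
        · simp only [T_ins_succ, tail0, Function.update_self,
            Function.update_of_ne (Fin.succ_ne_zero _)]
          refine T_lin c d hcc hdd (Fin.tail w) p _ _ _ (fun u v => ?_) τ
          have := h u (w p.succ * v)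
          simpa only [mul_assoc] using this
        · by_cases hkp : k = p
          · subst hkp
            simp only [T_ins_succ, tails, Function.update_self, Function.update_idem,
              Function.update_of_ne (Fin.succ_ne_zero _).symm]
            refine T_lin c d hcc hdd (Fin.tail w) k _ _ _ (fun u v => ?_) τ
            have := h (u * w 0) v
            simpa only [mul_assoc] using this
          · have hkp' : p.succ ≠ k.succ := fun e => hkp (Fin.succ_injective _ e).symm
            simp only [T_ins_succ, tails, Function.update_of_ne (Fin.succ_ne_zero _).symm,
              Function.update_of_ne hkp']
            simp only [Function.update_comm hkp]
            exact T_lin c d hcc hdd _ k _ _ _ h τ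

end TDef
end CHProof

namespace CHProof
open Equiv Equiv.Perm

section Comb
variable {n m : ℕ}

def Pm {K : Type} [Field K] (b : Perm (Fin m) → K) (c d : Fin m → Fin n) : K :=
  ∑ σ : Perm (Fin m), if d = c ∘ ⇑σ then b σ else 0

def G (K : Type) [Field K] (n : ℕ) (σ τ : Perm (Fin m)) : K :=
  ∑ c : Fin m → Fin n, if c ∘ τ = c ∘ σ then 1 else 0

lemma sum_G {K : Type} [Field K] (b : Perm (Fin m) → K) (τ : Perm (Fin m)) :
    ∑ σ, b σ * G K n σ τ = ∑ c : Fin m → Fin n, Pm b c (c ∘ τ) := by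
  simp only [G, Pm, Finset.mul_sum]
  rw [Finset.sum_comm]
  simp

lemma G_symm {K : Type} [Field K] (σ τ : Perm (Fin m)) : G K n σ τ = G K n τ σ := by
  simp only [G, eq_comm]

lemma gram_rat (b : Perm (Fin m) → ℚ) (h : ∀ τ, ∑ σ, b σ * G ℚ n σ τ = 0)
    (c d : Fin m → Fin n) : Pm b c d = 0 := by
  have h1 : ∀ c : Fin m → Fin n, ∑ d, Pm b c d * Pm b c d = ∑ τ, b τ * Pm b c (c ∘ τ) := by
    intro c
    have : ∀ d, Pm b c d * Pm b c d = ∑ τ : Perm (Fin m), if d = c ∘ ⇑τ then b τ * Pm b c d else 0 := by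
      intro d
      conv_lhs => enter [1]; rw [Pm]
      rw [Finset.sum_mul]
      simp
    simp only [this]
    rw [Finset.sum_comm]
    simp
  have h2 : ∑ c : Fin m → Fin n, ∑ d, Pm b c d * Pm b c d = 0 := by
    simp only [h1]
    rw [Finset.sum_comm]
    simp only [← Finset.mul_sum]
    simp only [← sum_G, h, mul_zero, Finset.sum_const_zero]
  have h3 := (Finset.sum_eq_zero_iff_of_nonneg (fun c _ => Finset.sum_nonneg
    (fun d _ => mul_self_nonneg _))).1 h2 c (Finset.mem_univ _)
  have h4 := (Finset.sum_eq_zero_iff_of_nonneg (fun d _ => mul_self_nonneg _)).1 h3 d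
    (Finset.mem_univ _)
  exact mul_self_eq_zero.1 h4

variable {K : Type} [Field K] [CharZero K]

lemma gram (b : Perm (Fin m) → K) (h : ∀ τ, ∑ σ, b σ * G K n σ τ = 0)
    (c d : Fin m → Fin n) : Pm b c d = 0 := by
  let _ : Algebra ℚ K := DivisionRing.toRatAlgebra
  rw [← Module.forall_dual_apply_eq_zero_iff ℚ]
  intro f
  have hf : ∀ (c d : Fin m → Fin n), f (Pm b c d) = Pm (fun σ => f (b σ)) c d := by
    intro c d
    simp only [Pm, map_sum]
    refine Finset.sum_congr rfl fun σ _ => ?_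
    split_ifs <;> simp
  rw [hf]
  apply gram_rat
  intro τ
  rw [sum_G]
  simp only [← hf]
  rw [← map_sum, ← sum_G, h, map_zero]

lemma exists_coeff (v : Perm (Fin m) → K)
    (hv : ∀ b : Perm (Fin m) → K, (∀ c d : Fin m → Fin n, Pm b c d = 0) → ∑ σ, b σ * v σ = 0) :
    ∃ a : Perm (Fin m) → K, ∀ τ, ∑ σ, a σ * G K n σ τ = v τ := by
  classical
  let M : Matrix (Perm (Fin m)) (Perm (Fin m)) K := Matrix.of fun σ τ => G K n σ τ
  by_contra hne
  have hmem : v ∉ LinearMap.range M.vecMulLinear := by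
    rintro ⟨a, ha⟩
    apply hne
    refine ⟨a, fun τ => ?_⟩
    rw [← ha]
    simp [Matrix.vecMul, dotProduct, M]
  obtain ⟨f, hf1, hf2⟩ := Submodule.exists_dual_map_eq_bot_of_notMem hmem inferInstance
  have hf3 : ∀ a : Perm (Fin m) → K, f (M.vecMulLinear a) = 0 := by
    intro a
    have : f (M.vecMulLinear a) ∈ (LinearMap.range M.vecMulLinear).map f := ⟨_, ⟨a, rfl⟩, rfl⟩
    exact (Submodule.mem_bot K).1 (hf2 ▸ this)
  let b : Perm (Fin m) → K := fun σ => f (Pi.single σ 1)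
  have hb : ∀ x, f x = ∑ σ, b σ * x σ := by
    intro x
    have hx : x = ∑ σ, x σ • (Pi.single σ (1:K) : Perm (Fin m) → K) := by
      ext τ; simp [Pi.single_apply]
    conv_lhs => rw [hx]
    rw [map_sum]
    refine Finset.sum_congr rfl fun σ _ => ?_
    rw [map_smul, smul_eq_mul, mul_comm]
  apply hf1
  rw [hb]
  apply hv
  apply gram
  intro τ
  have := hf3 (Pi.single τ 1)
  rw [hb] at this
  rw [← this]
  refine Finset.sum_congr rfl fun σ _ => ?_
  simp [M, G_symm]

/-- signed indicator of the symmetric group of `P` -/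
noncomputable def alt (K : Type) [Field K] (P : Finset (Fin m)) (h : Perm (Fin m)) : K :=
  if ∀ x, x ∉ P → h x = x then ((Perm.sign h : ℤ) : K) else 0

lemma Pm_alt (P : Finset (Fin m)) (hP : P.card = n + 1) (σ : Perm (Fin m)) (c d : Fin m → Fin n) :
    ∑ h : Perm (Fin m), (if d = c ∘ ⇑(σ * h) then alt K P h else 0) = 0 := by
  obtain ⟨x, hx, y, hy, hxy, he⟩ : ∃ x ∈ P, ∃ y ∈ P, x ≠ y ∧ c (σ x) = c (σ y) :=
    Finset.exists_ne_map_eq_of_card_lt_of_maps_to (t := Finset.univ) (by simp [hP])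
      (fun _ _ => Finset.mem_univ _)
  have key : ∑ h : Perm (Fin m), (if d = c ∘ ⇑(σ * h) then alt K P h else 0)
      = - ∑ h : Perm (Fin m), (if d = c ∘ ⇑(σ * h) then alt K P h else 0) := by
    conv_lhs => rw [← Equiv.sum_comp (Equiv.mulLeft (Equiv.swap x y))]
    rw [← Finset.sum_neg_distrib]
    refine Finset.sum_congr rfl fun h _ => ?_
    have h1 : c ∘ ⇑(σ * (Equiv.swap x y * h)) = c ∘ ⇑(σ * h) := by
      ext z
      simp only [Function.comp, Perm.mul_apply]
      by_cases h1 : h z = x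
      · rw [h1]; simp [he]
      · by_cases h2 : h z = y
        · rw [h2]; simp [he]
        · rw [swap_apply_of_ne_of_ne h1 h2]
    have h2 : alt K P (Equiv.swap x y * h) = - alt K P h := by
      have : (∀ z, z ∉ P → (Equiv.swap x y * h) z = z) ↔ (∀ z, z ∉ P → h z = z) := by
        refine forall_congr' fun z => forall_congr' fun hz => ?_
        rw [Perm.mul_apply, swap_apply_eq_iff, swap_apply_of_ne_of_ne]
        · rintro rfl; exact hz hx
        · rintro rfl; exact hz hy
      simp only [alt, this]
      split_ifs
      · simp [Perm.sign_swap hxy]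
      · simp
    simp only [Equiv.coe_mulLeft, h1, h2]
    split_ifs <;> simp
  exact self_eq_neg.1 key

def L (σ : Perm (Fin m)) : Lex (Fin m → Fin m) := toLex ⇑σ

lemma L_inj {σ τ : Perm (Fin m)} (h : L σ = L τ) : σ = τ := by
  apply Equiv.ext; intro x; exact congrFun h x

lemma alt_lt (P : Finset (Fin m)) (σ h : Perm (Fin m)) (hσ : StrictAntiOn σ P)
    (hh : ∀ x, x ∉ P → h x = x) (h1 : h ≠ 1) : L (σ * h) < L σ := by
  have hne : (Finset.univ.filter fun x => h x ≠ x).Nonempty := by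
    by_contra hcon
    apply h1
    apply Equiv.ext
    intro x
    by_contra hx
    exact hcon ⟨x, by simpa using hx⟩
  obtain ⟨p, hp, hmin⟩ := Finset.exists_min_image _ id hne
  simp only [Finset.mem_filter, Finset.mem_univ, true_and, id] at hp hmin
  have hfix : ∀ j, j < p → h j = j := by
    intro j hj
    by_contra hc
    exact absurd (hmin j hc) (not_le.2 hj)
  refine ⟨p, fun j hj => ?_, ?_⟩
  · change σ (h j) = σ j
    rw [hfix j hj]
  · change σ (h p) < σ p
    have hpP : p ∈ P := by by_contra hc; exact hp (hh p hc)
    have hhpP : h p ∈ P := by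
      by_contra hc; exact hp (h.injective (hh _ hc))
    apply hσ hpP hhpP
    rcases lt_trichotomy p (h p) with h2 | h2 | h2
    · exact h2
    · exact absurd h2.symm hp
    · exact absurd (h.injective (hfix _ h2)) hp

lemma exists_color (σ : Perm (Fin m))
    (hσ : ∀ P : Finset (Fin m), P.card = n + 1 → ¬ StrictAntiOn σ P) :
    ∃ col : Fin m → Fin n, ∀ x y, x < y → col x = col y → σ x < σ y := by
  classical
  let S : Fin m → Finset (Finset (Fin m)) := fun x =>
    Finset.univ.filter fun P => x ∈ P ∧ (∀ y ∈ P, y ≤ x) ∧ StrictAntiOn σ P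
  let l : Fin m → ℕ := fun x => (S x).sup Finset.card
  have hS : ∀ x P, P ∈ S x ↔ x ∈ P ∧ (∀ y ∈ P, y ≤ x) ∧ StrictAntiOn σ P := by
    intro x P; simp [S]
  have hsing : ∀ x, {x} ∈ S x := by intro x; rw [hS]; simp
  have hl1 : ∀ x, 1 ≤ l x := fun x => by
    have := Finset.le_sup (f := Finset.card) (hsing x)
    rw [Finset.card_singleton] at this
    exact this
  have hln : ∀ x, l x ≤ n := by
    intro x
    refine Finset.sup_le fun P hP => ?_
    by_contra hcon
    push Not at hcon
    obtain ⟨Q, hQ, hQc⟩ := Finset.exists_subset_card_eq (Nat.succ_le_of_lt hcon)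
    exact hσ Q hQc (((hS x P).1 hP).2.2.mono (by exact_mod_cast hQ))
  refine ⟨fun x => ⟨l x - 1, by have := hl1 x; have := hln x; omega⟩, fun x y hxy hcol => ?_⟩
  by_contra hcon
  have hlt : σ y < σ x := lt_of_le_of_ne (not_lt.1 hcon) (fun e => hxy.ne' (σ.injective e))
  have : l x + 1 ≤ l y := by
    obtain ⟨P, hP, hPl⟩ := Finset.exists_mem_eq_sup (S x) ⟨_, hsing x⟩ Finset.card
    obtain ⟨h1, h2, h3⟩ := (hS x P).1 hP
    have hyP : y ∉ P := fun h => absurd (h2 y h) (not_le.2 hxy)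
    have : insert y P ∈ S y := by
      rw [hS]
      refine ⟨Finset.mem_insert_self _ _, ?_, ?_⟩
      · intro z hz
        rcases Finset.mem_insert.1 hz with rfl | hz
        · exact le_rfl
        · exact (h2 z hz).trans hxy.le
      · intro a ha b hb hab
        rw [Finset.mem_coe, Finset.mem_insert] at ha hb
        rcases ha with rfl | ha
        · rcases hb with rfl | hb
          · exact absurd hab (lt_irrefl _)
          · exact absurd (hab.trans_le (h2 b hb)) (not_lt.2 hxy.le)
        · rcases hb with rfl | hb
          · refine hlt.trans_le ?_
            exact h3.antitoneOn ha h1 (h2 a ha)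
          · exact h3 ha hb hab
    have h4 := Finset.le_sup (f := Finset.card) this
    rw [Finset.card_insert_of_notMem hyP] at h4
    change (S x).sup Finset.card + 1 ≤ _
    rw [hPl]; exact h4
  have h5 := congrArg Fin.val hcol
  have := hl1 x
  have := hl1 y
  simp only at h5
  omega

lemma color_le (σ τ : Perm (Fin m)) (col : Fin m → Fin n)
    (hcol : ∀ x y, x < y → col x = col y → σ x < σ y)
    (h : col = (col ∘ ⇑σ⁻¹) ∘ τ) : L σ ≤ L τ := by
  by_cases hst : σ = τ
  · rw [hst]
  have hne : (Finset.univ.filter fun x => σ x ≠ τ x).Nonempty := by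
    by_contra hcon
    apply hst
    apply Equiv.ext
    intro x
    by_contra hx
    exact hcon ⟨x, by simpa using hx⟩
  obtain ⟨p, hp, hmin⟩ := Finset.exists_min_image _ id hne
  simp only [Finset.mem_filter, Finset.mem_univ, true_and, id] at hp hmin
  have hfix : ∀ j, j < p → σ j = τ j := by
    intro j hj
    by_contra hc
    exact absurd (hmin j hc) (not_le.2 hj)
  apply le_of_lt
  refine ⟨p, fun j hj => hfix j hj, ?_⟩
  change σ p < τ p
  have h2 : col p = col (σ⁻¹ (τ p)) := congrFun h p
  have h3 : σ (σ⁻¹ (τ p)) = τ p := by simp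
  rcases lt_trichotomy p (σ⁻¹ (τ p)) with h4 | h4 | h4
  · have := hcol _ _ h4 h2
    rwa [h3] at this
  · exact absurd (by rw [← h3, ← h4]) hp
  · have := hfix _ h4
    rw [h3] at this
    have := τ.injective this
    exact absurd h4 (by rw [← this]; exact lt_irrefl _)

theorem straighten {V : Type} [AddCommGroup V] [Module K V] (f : Perm (Fin m) → V)
    (hf : ∀ (σ : Perm (Fin m)) (P : Finset (Fin m)), P.card = n + 1 →
      ∑ h : Perm (Fin m), alt K P h • f (σ * h) = 0)
    (b : Perm (Fin m) → K) (hb : ∀ c d : Fin m → Fin n, Pm b c d = 0) :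
    ∑ σ, b σ • f σ = 0 := by
  classical
  have step : ∀ b : Perm (Fin m) → K, (∀ c d : Fin m → Fin n, Pm b c d = 0) →
      (∀ σ0, b σ0 ≠ 0 → ∀ b' : Perm (Fin m) → K, (∀ σ, b' σ ≠ 0 → L σ < L σ0) →
        (∀ c d : Fin m → Fin n, Pm b' c d = 0) → ∑ σ, b' σ • f σ = 0) →
      ∑ σ, b σ • f σ = 0 := by
    intro b hb ih
    by_cases hne : (Finset.univ.filter fun σ => b σ ≠ 0).Nonempty
    swap
    · apply Finset.sum_eq_zero
      intro σ _
      have : b σ = 0 := by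
        by_contra hc
        exact hne ⟨σ, by simpa using hc⟩
      rw [this, zero_smul]
    obtain ⟨σ0, h0, hmax⟩ := Finset.exists_max_image _ L hne
    simp only [Finset.mem_filter, Finset.mem_univ, true_and] at h0 hmax
    by_cases hgood : ∀ P : Finset (Fin m), P.card = n + 1 → ¬ StrictAntiOn σ0 P
    · exfalso
      obtain ⟨col, hcol⟩ := exists_color σ0 hgood
      apply h0
      have h1 := hb (col ∘ ⇑σ0⁻¹) col
      rw [Pm, Finset.sum_eq_single σ0, if_pos] at h1
      · exact h1
      · ext x; simp
      · intro τ _ hτ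
        by_cases h2 : col = (col ∘ ⇑σ0⁻¹) ∘ τ
        · rw [if_pos h2]
          by_contra h3
          exact hτ (L_inj (le_antisymm (hmax τ h3) (color_le σ0 τ col hcol h2)))
        · rw [if_neg h2]
      · simp
    · push Not at hgood
      obtain ⟨P, hPc, hP⟩ := hgood
      let κ : Perm (Fin m) → K := fun ρ => alt K P (σ0⁻¹ * ρ)
      have hκf : ∑ ρ, κ ρ • f ρ = 0 := by
        rw [← Equiv.sum_comp (Equiv.mulLeft σ0)]
        simpa [κ] using hf σ0 P hPc
      have hκP : ∀ c d : Fin m → Fin n, Pm κ c d = 0 := by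
        intro c d
        rw [Pm, ← Equiv.sum_comp (Equiv.mulLeft σ0)]
        have := Pm_alt (K := K) P hPc σ0 c d
        refine Eq.trans (Finset.sum_congr rfl fun h _ => ?_) this
        have e : κ (σ0 * h) = alt K P h := by simp only [κ]; rw [inv_mul_cancel_left]
        simp only [Equiv.coe_mulLeft, e]
      have hsub := ih σ0 h0 (fun ρ => b ρ - b σ0 * κ ρ) ?_ ?_
      · simp only [sub_smul, Finset.sum_sub_distrib, mul_smul] at hsub
        rw [← Finset.smul_sum, hκf, smul_zero, sub_zero] at hsub
        exact hsub
      · intro ρ hρ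
        by_cases hρ0 : ρ = σ0
        · subst hρ0
          exfalso; apply hρ
          have e : κ ρ = 1 := by
            simp only [κ]
            rw [inv_mul_cancel]
            simp [alt]
          simp [e]
        · by_cases hbρ : b ρ = 0
          · have hκρ : κ ρ ≠ 0 := by
              intro h; apply hρ; simp [h, hbρ]
            have h5 : ∀ x, x ∉ P → (σ0⁻¹ * ρ) x = x := by
              by_contra hc; apply hκρ; simp only [κ, alt]; rw [if_neg hc]
            have h6 := alt_lt P σ0 (σ0⁻¹ * ρ) hP h5 (by
              intro h; apply hρ0; rw [inv_mul_eq_one] at h; exact h.symm)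
            simpa using h6
          · exact lt_of_le_of_ne (hmax ρ hbρ) (fun h => hρ0 (L_inj h))
      · intro c d
        have : Pm (fun ρ => b ρ - b σ0 * κ ρ) c d = Pm b c d - b σ0 * Pm κ c d := by
          simp only [Pm, Finset.mul_sum, ← Finset.sum_sub_distrib]
          refine Finset.sum_congr rfl fun ρ _ => ?_
          split_ifs <;> simp
        rw [this, hb, hκP]; simp
  have Q : ∀ x : Lex (Fin m → Fin m), ∀ b' : Perm (Fin m) → K, (∀ σ, b' σ ≠ 0 → L σ < x) →
        (∀ c d : Fin m → Fin n, Pm b' c d = 0) → ∑ σ, b' σ • f σ = 0 := by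
    intro x
    induction x using WellFoundedLT.induction with
    | _ x ih =>
      intro b' hb' hP
      exact step b' hP (fun σ0 h0 => ih _ (hb' σ0 h0))
  exact step b hb (fun σ0 _ => Q _)

end Comb
end CHProof

namespace CHProof
open Equiv Equiv.Perm

set_option linter.unusedSimpArgs false
set_option linter.unusedVariables false
set_option linter.unusedSectionVars false

section Polar
variable {K : Type} [Field K] [CharZero K]

lemma polar {V N : Type} [AddCommGroup V] [Module K V] [AddCommGroup N] [Module K N] {n : ℕ}
    (M : MultilinearMap K (fun _ : Fin n => V) N)
    (hsymm : ∀ (π : Perm (Fin n)) v, M (v ∘ π) = M v)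
    (hdiag : ∀ a, M (fun _ => a) = 0) (v : Fin n → V) : M v = 0 := by
  classical
  have h1 : ∀ s : Finset (Fin n), ∑ r : Fin n → Fin n, (if ∀ i, r i ∈ s then M (v ∘ r) else 0) = 0 := by
    intro s
    have := M.map_sum_finset (fun _ j => v j) (fun _ => s)
    rw [hdiag] at this
    rw [← Finset.sum_filter]
    rw [this]
    refine Finset.sum_congr ?_ fun _ _ => rfl
    ext r; simp
  have h2 : ∑ r : Fin n → Fin n, ∑ s : Finset (Fin n),
      ((-1 : ℤ)^s.card) • (if ∀ i, r i ∈ s then M (v ∘ r) else 0) = 0 := by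
    rw [Finset.sum_comm]
    simp only [← Finset.smul_sum, h1, smul_zero, Finset.sum_const_zero]
  have h3 : ∀ r : Fin n → Fin n, ∑ s : Finset (Fin n),
      ((-1 : ℤ)^s.card) • (if ∀ i, r i ∈ s then M (v ∘ r) else 0)
      = if Function.Surjective r then ((-1 : ℤ)^n) • M v else 0 := by
    intro r
    split_ifs with hr
    · rw [Finset.sum_eq_single Finset.univ]
      · have hb : Function.Bijective r := ⟨Finite.injective_iff_surjective.2 hr, hr⟩
        have := hsymm (Equiv.ofBijective r hb) v
        rw [Equiv.coe_ofBijective] at this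
        simp [this]
      · intro s _ hs
        rw [if_neg, smul_zero]
        intro h
        apply hs
        ext x
        obtain ⟨y, rfl⟩ := hr x
        simp [h y]
      · simp
    · simp only [Function.Surjective] at hr
      push Not at hr
      obtain ⟨x, hx⟩ := hr
      refine Finset.sum_involution (fun s _ => if x ∈ s then s.erase x else insert x s) ?_ ?_ ?_ ?_
      · intro s _
        by_cases hxs : x ∈ s
        · have e : (∀ i, r i ∈ s.erase x) ↔ ∀ i, r i ∈ s := by simp [hx]
          simp only [if_pos hxs, e]
          obtain ⟨k, hk⟩ : ∃ k, s.card = k + 1 := ⟨s.card - 1, by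
            have := Finset.card_pos.2 ⟨x, hxs⟩; omega⟩
          rw [Finset.card_erase_of_mem hxs, hk]
          split_ifs <;> simp [pow_succ]
        · have e : (∀ i, r i ∈ insert x s) ↔ ∀ i, r i ∈ s := by simp [hx]
          simp only [if_neg hxs, e]
          rw [Finset.card_insert_of_notMem hxs]
          split_ifs <;> simp [pow_succ]
      · intro s _ _
        by_cases hxs : x ∈ s
        · simp only [if_pos hxs]
          intro h; rw [← h] at hxs; simp at hxs
        · simp only [if_neg hxs]
          intro h; rw [← h] at hxs; simp at hxs
      · intro s _; exact Finset.mem_univ _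
      · intro s _
        by_cases hxs : x ∈ s
        · simp [hxs]
        · simp [hxs]
  simp only [h3] at h2
  rw [← Finset.sum_filter, Finset.sum_const] at h2
  set N0 := (Finset.univ.filter fun r : Fin n → Fin n => Function.Surjective r).card with hN0
  have hN : N0 ≠ 0 := by
    rw [hN0]
    apply Finset.card_ne_zero_of_mem (a := id)
    simp [Function.surjective_id]
  have h4 : ((N0 : K) * (-1 : K)^n) • M v = 0 := by
    rw [mul_smul, Nat.cast_smul_eq_nsmul, ← h2, ← Int.cast_smul_eq_zsmul K]
    simp
  rcases smul_eq_zero.1 h4 with h | h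
  · exfalso
    rcases mul_eq_zero.1 h with h | h
    · exact hN (by exact_mod_cast h)
    · exact pow_ne_zero _ (by norm_num) h
  · exact h
end Polar

inductive Wd (R : Type) : Type
  | reg (r : R) : Wd R
  | spec (b c : R) : Wd R
  | zero : Wd R

namespace Wd
variable {R : Type} [Ring R]

def mul : Wd R → Wd R → Wd R
  | reg a, reg b => reg (a * b)
  | reg a, spec b c => spec (a * b) c
  | spec b c, reg a => spec b (c * a)
  | _, _ => zero

instance : Monoid (Wd R) where
  mul := mul
  one := reg 1
  mul_assoc := by
    intro x y z
    change mul (mul x y) z = mul x (mul y z)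
    cases x <;> cases y <;> cases z <;> simp [mul, mul_assoc]
  one_mul := by
    intro x
    change mul (reg 1) x = x
    cases x <;> simp [mul]
  mul_one := by
    intro x
    change mul x (reg 1) = x
    cases x <;> simp [mul]

lemma one_def : (1 : Wd R) = reg 1 := rfl
@[simp] lemma reg_mul_reg (a b : R) : reg a * reg b = reg (a * b) := rfl
@[simp] lemma reg_mul_spec (a b c : R) : reg a * spec b c = spec (a * b) c := rfl
@[simp] lemma spec_mul_reg (a b c : R) : spec b c * reg a = spec b (c * a) := rfl
@[simp] lemma spec_mul_spec (a b c d : R) : spec b c * spec a d = zero := rfl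
@[simp] lemma zero_mul' (x : Wd R) : zero * x = zero := by cases x <;> rfl
@[simp] lemma mul_zero' (x : Wd R) : x * zero = zero := by cases x <;> rfl

def N : Wd R → ℕ
  | reg _ => 0
  | spec _ _ => 1
  | zero => 2

end Wd
open Wd

abbrev Cf (R : Type) := TrivSqZeroExt R R

section Main
variable {K : Type} [Field K] [CharZero K] {R : Type} [Ring R] [Algebra K R] (D : TraceData K R)

/-- traces of letters -/
def tt : Wd R → Cf R
  | .reg r => TrivSqZeroExt.inl (D.Tr r)
  | .spec b c => TrivSqZeroExt.inr (c * b)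
  | .zero => 0

@[simp] lemma tt_reg (r : R) : tt D (reg r) = TrivSqZeroExt.inl (D.Tr r) := rfl
@[simp] lemma tt_spec (b c : R) : tt D (spec b c) = TrivSqZeroExt.inr (c * b) := rfl
@[simp] lemma tt_zero : tt D (zero : Wd R) = 0 := rfl

lemma tt_mul_comm (x y : Wd R) : tt D (x * y) = tt D (y * x) := by
  cases x <;> cases y <;> simp [D.trace_mul_comm, mul_assoc]

lemma tt_comm (x y : Wd R) : tt D x * tt D y = tt D y * tt D x := by
  cases x <;> cases y
  case reg.reg a b =>
    simp only [tt_reg, ← TrivSqZeroExt.inl_mul]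
    rw [D.central]
  case reg.spec a b c =>
    ext
    · simp
    · simp [D.central]
  case spec.reg a b c =>
    ext
    · simp
    · simp [D.central]
  case spec.spec a b c d => simp only [tt_spec, TrivSqZeroExt.inr_mul_inr]
  all_goals simp

/-- central elements compatible with the trace -/
def Zc : Subalgebra K R where
  carrier := {s | (∀ r, s * r = r * s) ∧ ∀ r, D.Tr (s * r) = s * D.Tr r}
  mul_mem' := by
    rintro a b ⟨h1, h2⟩ ⟨h3, h4⟩
    refine ⟨fun r => ?_, fun r => ?_⟩
    · rw [mul_assoc, h3, ← mul_assoc, h1, mul_assoc]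
    · rw [mul_assoc, h2, h4, mul_assoc]
  add_mem' := by
    rintro a b ⟨h1, h2⟩ ⟨h3, h4⟩
    refine ⟨fun r => ?_, fun r => ?_⟩
    · rw [add_mul, mul_add, h1, h3]
    · rw [add_mul, map_add, h2, h4, add_mul]
  algebraMap_mem' := by
    intro k
    refine ⟨fun r => Algebra.commutes _ _, fun r => ?_⟩
    rw [← Algebra.smul_def, ← Algebra.smul_def, map_smul]

lemma Tr_mem (r : R) : D.Tr r ∈ Zc D := ⟨fun s => D.central _ _, fun s => D.trace_trace _ _⟩

lemma sigma_mem (a : R) (k : ℕ) : traceSigma D a k ∈ Zc D := by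
  induction k using Nat.strong_induction_on with
  | _ k ih =>
    cases k with
    | zero => rw [traceSigma]; exact one_mem _
    | succ k =>
      rw [traceSigma]
      refine (Zc D).smul_mem (sum_mem fun i hi => ?_) _
      refine mul_mem (mul_mem (pow_mem (neg_mem (one_mem _)) _) (ih _ (by omega))) (Tr_mem D _)

lemma tt_mul_inl (x : Wd R) (r s : R) (hs : s ∈ Zc D) :
    tt D (x * reg r) * TrivSqZeroExt.inl s = tt D (x * reg (s * r)) := by
  cases x with
  | zero => simp
  | reg a =>
    simp only [reg_mul_reg, tt_reg, ← TrivSqZeroExt.inl_mul]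
    rw [← mul_assoc a s r, ← hs.1 a, mul_assoc s a r, hs.2, hs.1]
  | spec b c =>
    simp only [spec_mul_reg, tt_spec]
    ext
    · simp
    · simp
      rw [← hs.1, ← mul_assoc, ← mul_assoc, hs.1, mul_assoc c s r]

lemma tt_add (x : Wd R) (r s : R) : tt D (x * reg (r + s)) = tt D (x * reg r) + tt D (x * reg s) := by
  cases x <;> simp [mul_add, add_mul, add_smul]


def Fil (k : ℕ) (c : Cf R) : Prop := (1 ≤ k → c.fst = 0) ∧ (2 ≤ k → c = 0)

lemma Fil.mul {k l : ℕ} {c d : Cf R} (h1 : Fil k c) (h2 : Fil l d) : Fil (k + l) (c * d) := by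
  constructor
  · intro h
    rcases Nat.eq_zero_or_pos k with rfl | hk
    · rw [TrivSqZeroExt.fst_mul, h2.1 (by omega), mul_zero]
    · rw [TrivSqZeroExt.fst_mul, h1.1 (by omega), zero_mul]
  · intro h
    by_cases hk : 2 ≤ k
    · rw [h1.2 hk, zero_mul]
    by_cases hl : 2 ≤ l
    · rw [h2.2 hl, mul_zero]
    ext
    · rw [TrivSqZeroExt.fst_mul, h1.1 (by omega), zero_mul]; rfl
    · rw [TrivSqZeroExt.snd_mul, h1.1 (by omega), h2.1 (by omega)]; simp

lemma Fil_tt (x : Wd R) : Fil x.N (tt D x) := by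
  cases x <;> constructor <;> simp [Wd.N]

lemma Fil_mul_N (x y : Wd R) (r : ℕ) (c : Cf R) (h : Fil ((x * y).N + r) c) :
    Fil (x.N + y.N + r) c := by
  cases x <;> cases y <;> constructor <;> intro h1 <;>
    first
    | exact h.2 (by simp only [reg_mul_reg, reg_mul_spec, spec_mul_reg, spec_mul_spec,
        zero_mul', mul_zero', Wd.N] at *; omega)
    | exact h.1 (by simp only [reg_mul_reg, reg_mul_spec, spec_mul_reg, spec_mul_spec,
        zero_mul', mul_zero', Wd.N] at *; omega)

lemma Fil_T : ∀ {m : ℕ} (w : Fin m → Wd R) (σ : Perm (Fin m)), Fil (∑ i, (w i).N) (T (tt D) m w σ)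
  | 0, w, σ => by constructor <;> simp
  | m+1, w, σ => by
      obtain ⟨p, τ, rfl⟩ := exists_ins σ
      rw [Fin.sum_univ_succ]
      obtain rfl | ⟨k, rfl⟩ := Fin.eq_zero_or_eq_succ p
      · rw [T_ins_zero]
        exact (Fil_tt D _).mul (Fil_T (Fin.tail w) τ)
      · rw [T_ins_succ]
        have h := Fil_T (Function.update (Fin.tail w) k (w 0 * w k.succ)) τ
        rw [← Finset.add_sum_erase _ _ (Finset.mem_univ k)] at h ⊢
        rw [Function.update_self] at h
        have h2 := Fil_mul_N _ _ _ _ h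
        rw [add_assoc] at h2
        convert h2 using 3
        refine Finset.sum_congr rfl fun i hi => ?_
        rw [Function.update_of_ne (Finset.ne_of_mem_erase hi)]
        rfl

lemma T_two {m : ℕ} (w : Fin m → Wd R) (σ : Perm (Fin m)) (i j : Fin m) (hij : i ≠ j)
    (hi : 1 ≤ (w i).N) (hj : 1 ≤ (w j).N) : T (tt D) m w σ = 0 := by
  refine (Fil_T D w σ).2 ?_
  rw [← Finset.add_sum_erase _ _ (Finset.mem_univ i)]
  have : (w j).N ≤ ∑ x ∈ Finset.univ.erase i, (w x).N :=
    Finset.single_le_sum (f := fun x => (w x).N) (fun _ _ => Nat.zero_le _)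
      (Finset.mem_erase.2 ⟨hij.symm, Finset.mem_univ _⟩)
  omega

/-- the fundamental trace polynomial -/
def F (m : ℕ) (w : Fin m → Wd R) : Cf R := ∑ σ : Perm (Fin m), (Perm.sign σ : ℤ) • T (tt D) m w σ

lemma F_symm {m : ℕ} (π : Perm (Fin m)) (w : Fin m → Wd R) : F D m (w ∘ π) = F D m w := by
  simp only [F]
  rw [← Equiv.sum_comp (MulAut.conj π⁻¹).toEquiv]
  refine Finset.sum_congr rfl fun σ _ => ?_
  have h1 : (MulAut.conj π⁻¹).toEquiv σ = π⁻¹ * σ * π := by simp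
  rw [h1, T_conj _ (tt_mul_comm D) (tt_comm D)]
  congr 2
  rw [Perm.sign_mul, Perm.sign_mul, Perm.sign_inv, mul_right_comm, Int.units_mul_self, one_mul]

lemma F_rec {m : ℕ} (w : Fin (m+1) → Wd R) : F D (m+1) w = tt D (w 0) * F D m (Fin.tail w)
    - ∑ k, F D m (Function.update (Fin.tail w) k (w 0 * w k.succ)) := by
  simp only [F]
  rw [sum_ins, Fin.sum_univ_succ, sub_eq_add_neg, ← Finset.sum_neg_distrib]
  congr 1
  · rw [Finset.mul_sum]
    refine Finset.sum_congr rfl fun τ _ => ?_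
    rw [T_ins_zero, sign_ins, mul_smul_comm]
    simp
  · refine Finset.sum_congr rfl fun k _ => ?_
    rw [← Finset.sum_neg_distrib]
    refine Finset.sum_congr rfl fun τ _ => ?_
    rw [T_ins_succ, sign_ins]
    simp

lemma F_const (m : ℕ) (x : Wd R) (a : R) :
    F D (m+2) (Fin.cons x fun _ => reg a) = tt D x * F D (m+1) (fun _ => reg a)
      - ((m:ℤ)+1) • F D (m+1) (Fin.cons (x * reg a) fun _ => reg a) := by
  rw [F_rec]
  have h1 : Fin.tail (Fin.cons x fun _ => reg a : Fin (m+2) → Wd R) = fun _ => reg a := by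
    rw [Fin.tail_cons]
  have h2 : ∀ k : Fin (m+1), F D (m+1) (Function.update (fun _ => reg a) k (x * reg a))
      = F D (m+1) (Fin.cons (x * reg a) fun _ => reg a) := by
    intro k
    rw [← F_symm D (swap 0 k) (Fin.cons (x * reg a) fun _ => reg a)]
    congr 1
    ext i
    by_cases hi : i = k
    · subst hi; simp
    · rw [Function.update_of_ne hi]
      simp only [Function.comp]
      obtain ⟨j, hj⟩ := Fin.exists_succ_eq.2 (show swap 0 k i ≠ 0 by
        rw [Ne, swap_apply_eq_iff, swap_apply_left]; exact hi)
      rw [← hj]; rfl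
  simp only [h1, Fin.cons_zero, Fin.cons_succ, h2]
  simp [add_smul]

noncomputable def Q (a : R) : ℕ → R
  | 0 => 1
  | m+1 => a * Q a m + (-1)^(m+1) * traceSigma D a (m+1)

lemma Q_eq (a : R) (m : ℕ) : Q D a m = ∑ k ∈ Finset.range (m + 1),
    (-1 : R) ^ k * traceSigma D a k * a ^ (m - k) := by
  induction m with
  | zero => simp [Q, traceSigma]
  | succ m ih =>
    rw [Finset.sum_range_succ, Q, ih, Nat.sub_self, pow_zero, mul_one, Finset.mul_sum]
    congr 1
    refine Finset.sum_congr rfl fun k hk => ?_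
    have hz : (-1 : R)^k * traceSigma D a k ∈ Zc D :=
      mul_mem (pow_mem (neg_mem (one_mem _)) _) (sigma_mem D a k)
    have : m + 1 - k = (m - k) + 1 := by
      have := Finset.mem_range.1 hk; omega
    rw [this, pow_succ', ← mul_assoc a, ← mul_assoc _ a, hz.1]

lemma Q_tr (a : R) (m : ℕ) : ((m:K)+1) • traceSigma D a (m+1) = (-1)^m * D.Tr (a * Q D a m) := by
  rw [traceSigma, smul_smul, mul_inv_cancel₀ (by exact_mod_cast Nat.succ_ne_zero m), one_smul, Q_eq, Finset.mul_sum, map_sum,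
    ← Finset.sum_range_reflect, Finset.mul_sum]
  refine Finset.sum_congr rfl fun k hk => ?_
  have hkm := Finset.mem_range.1 hk
  have hz : (-1 : R)^k * traceSigma D a k ∈ Zc D :=
      mul_mem (pow_mem (neg_mem (one_mem _)) _) (sigma_mem D a k)
  rw [← mul_assoc a, ← hz.1, mul_assoc _ a, hz.2, ← pow_succ']
  have e1 : m - (m + 1 - 1 - k) = k := by omega
  have e2 : m + 1 - 1 - k = m - k := by omega
  rw [e1, e2, ← mul_assoc ((-1)^m), ← mul_assoc ((-1)^m)]
  have e3 : m = (m - k) + k := by omega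
  have e4 : (-1 : R)^m * (-1)^k = (-1)^(m-k) := by
    conv_lhs => rw [e3]
    rw [pow_add, mul_assoc, ← pow_add, (Even.add_self k).neg_one_pow, mul_one]
  rw [e4]

lemma tt_smul (x : Wd R) (z : ℤ) (r : R) : tt D (x * reg (z • r)) = z • tt D (x * reg r) := by
  let φ : R →+ Cf R := AddMonoidHom.mk' (fun r => tt D (x * reg r)) (fun r s => tt_add D x r s)
  exact map_zsmul φ z r

lemma F_diag (m : ℕ) (x : Wd R) (a : R) :
    F D (m+1) (Fin.cons x fun _ => reg a)
      = ((-1)^m * (m.factorial : ℤ)) • tt D (x * reg (Q D a m)) := by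
  induction m generalizing x with
  | zero =>
    rw [F_rec]
    have h1 : x * reg (Q D a 0) = x := by
      rw [Q]; exact mul_one x
    rw [h1]
    simp [F, T]
  | succ m ih =>
    rw [F_const, ih]
    have hc : (fun _ => reg a : Fin (m+1) → Wd R) = Fin.cons (reg a) (fun _ => reg a) := by
      ext i; refine Fin.cases ?_ (fun i => ?_) i <;> rfl
    rw [hc, ih]
    have h1 : tt D (reg a * reg (Q D a m)) = (-1 : ℤ)^m • ((m : ℤ) + 1) •
        (TrivSqZeroExt.inl (traceSigma D a (m+1)) : Cf R) := by
      have h := Q_tr D a m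
      have h2 : D.Tr (a * Q D a m) = (-1 : ℤ)^m • ((m : ℤ) + 1) • traceSigma D a (m+1) := by
        have : ((m:ℤ)+1) • traceSigma D a (m+1) = ((m:K)+1) • traceSigma D a (m+1) := by
          rw [← Int.cast_smul_eq_zsmul K]; simp
        rw [this, h, zsmul_eq_mul]
        push_cast
        rw [← mul_assoc, ← pow_add, (Even.add_self m).neg_one_pow, one_mul]
      rw [reg_mul_reg, tt_reg, h2]
      rw [TrivSqZeroExt.inl_smul, TrivSqZeroExt.inl_smul]
    rw [h1]
    have h3 : tt D x * (TrivSqZeroExt.inl (traceSigma D a (m+1)) : Cf R)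
        = tt D (x * reg (traceSigma D a (m+1))) := by
      have := tt_mul_inl D x 1 _ (sigma_mem D a (m+1))
      rw [mul_one] at this
      rw [← this]
      congr 2
      exact (mul_one x).symm
    simp only [mul_smul_comm, h3]
    have h4 : reg (Q D a (m+1)) = reg (a * Q D a m + (-1 : ℤ)^(m+1) • traceSigma D a (m+1)) := by
      rw [Q, zsmul_eq_mul]; push_cast; rfl
    rw [h4, tt_add, tt_smul, mul_assoc x, reg_mul_reg]
    simp only [smul_smul, smul_add]
    have h5 : ((m+1).factorial : ℤ) = (m + 1) * m.factorial := by
      rw [Nat.factorial_succ]; push_cast; ring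
    have h6 : ((-1 : ℤ)^m) * (-1)^m = 1 := by rw [← mul_pow]; simp
    rw [h5, sub_eq_add_neg, ← neg_smul, add_comm]
    congr 2
    · ring
    · rw [pow_succ]
      linear_combination (0 : ℤ) * h6

variable {n : ℕ} (hCH : IsCayleyHamilton D n)

lemma tt_reg_smul (k : K) (x u v : Wd R) (r s s' : R) (h : r = k • s + s') :
    tt D (u * reg r * v) = algebraMap K (Cf R) k * tt D (u * reg s * v) + 1 * tt D (u * reg s' * v) := by
  subst h
  rw [← Algebra.smul_def, one_mul]
  cases u <;> cases v <;> ext <;> simp [mul_add, add_mul]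

lemma T_reg_lin {m : ℕ} (w : Fin m → Wd R) (i : Fin m) (k : K) (s s' : R) (σ : Perm (Fin m)) :
    T (tt D) m (Function.update w i (reg (k • s + s'))) σ
      = k • T (tt D) m (Function.update w i (reg s)) σ + T (tt D) m (Function.update w i (reg s')) σ := by
  have := T_lin (tt D) (algebraMap K (Cf R) k) 1 (fun x => Algebra.commutes _ _)
    (fun x => Commute.one_left _) w i (reg (k • s + s')) (reg s) (reg s')
    (fun u v => tt_reg_smul D k 1 u v _ _ _ rfl) σ
  rw [this, one_mul, Algebra.smul_def]

lemma F_reg_lin {m : ℕ} (w : Fin m → Wd R) (i : Fin m) (k : K) (s s' : R) :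
    F D m (Function.update w i (reg (k • s + s')))
      = k • F D m (Function.update w i (reg s)) + F D m (Function.update w i (reg s')) := by
  simp only [F, T_reg_lin, smul_add, Finset.sum_add_distrib, Finset.smul_sum]
  congr 1
  refine Finset.sum_congr rfl fun σ _ => ?_
  rw [smul_comm]

include hCH in
lemma F_zero_aux (x : Wd R) (v : Fin n → R) : F D (n+1) (Fin.cons x (fun i => reg (v i))) = 0 := by
  have key : ∀ [DecidableEq (Fin n)] (v : Fin n → R) (i : Fin n) (r : R),
      (Fin.cons x (fun j => reg (Function.update v i r j)) : Fin (n+1) → Wd R)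
      = Function.update (Fin.cons x (fun i => reg (v i)) : Fin (n+1) → Wd R) i.succ (reg r) := by
    intro _ v i r
    ext j
    refine Fin.cases ?_ (fun j => ?_) j
    · rfl
    · simp only [Fin.cons_succ, Function.update_apply, Fin.succ_inj]
      split_ifs <;> rfl
  have hz : ∀ (w : Fin (n+1) → Wd R) (i : Fin (n+1)), F D (n+1) (Function.update w i (reg 0)) = 0 := by
    intro w i
    have := F_reg_lin D w i (1:K) 0 0
    simpa using this
  let M : MultilinearMap K (fun _ : Fin n => R) (Cf R) :=
    { toFun := fun v => F D (n+1) (Fin.cons x (fun i => reg (v i)))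
      map_update_add' := by
        intro _ v i r s
        simp only [key]
        have := F_reg_lin D (Fin.cons x (fun i => reg (v i)) : Fin (n+1) → Wd R) i.succ (1:K) r s
        simpa using this
      map_update_smul' := by
        intro _ v i k r
        simp only [key]
        have := F_reg_lin D (Fin.cons x (fun i => reg (v i)) : Fin (n+1) → Wd R) i.succ k r 0
        rw [hz] at this
        simpa using this }
  refine polar M ?_ ?_ v
  · intro π v
    change F D (n+1) _ = F D (n+1) _
    rw [← F_symm D (ins 0 π) (Fin.cons x (fun i => reg (v i)))]
    congr 1
    ext j
    refine Fin.cases ?_ (fun j => ?_) j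
    · simp [ins_zero]
    · simp [ins_succ]
  · intro a
    change F D (n+1) _ = 0
    rw [F_diag, Q_eq, hCH.2]
    have := tt_smul D x 0 0
    simp only [zero_smul] at this
    rw [this, smul_zero]

include hCH in
lemma F_zero (w : Fin (n+1) → Wd R) : F D (n+1) w = 0 := by
  classical
  by_cases h : ∃ i, 1 ≤ (w i).N
  · obtain ⟨i, hi⟩ := h
    by_cases h2 : ∃ j, i ≠ j ∧ 1 ≤ (w j).N
    · obtain ⟨j, hij, hj⟩ := h2
      rw [F]
      refine Finset.sum_eq_zero fun σ _ => ?_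
      rw [T_two D w σ i j hij hi hj, smul_zero]
    · push Not at h2
      rw [← F_symm D (swap 0 i)]
      have : ∀ j : Fin n, ∃ r, (w ∘ swap 0 i) j.succ = reg r := by
        intro j
        have h3 := h2 (swap 0 i j.succ) (by
          intro h; rw [eq_comm, swap_apply_eq_iff, swap_apply_right] at h
          exact Fin.succ_ne_zero _ h)
        simp only [Function.comp]
        cases hw : w (swap 0 i j.succ) with
        | reg r => exact ⟨r, rfl⟩
        | spec b c => rw [hw] at h3; simp [Wd.N] at h3
        | zero => rw [hw] at h3; simp [Wd.N] at h3
      choose v hv using this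
      have e : w ∘ swap 0 i = Fin.cons ((w ∘ swap 0 i) 0) (fun i => reg (v i)) := by
        ext j; refine Fin.cases rfl (fun j => ?_) j
        rw [hv, Fin.cons_succ]
      rw [e]
      exact F_zero_aux D hCH _ _
  · push Not at h
    have : ∀ j : Fin n, ∃ r, w j.succ = reg r := by
      intro j
      have h3 := h j.succ
      cases hw : w j.succ with
      | reg r => exact ⟨r, rfl⟩
      | spec b c => rw [hw] at h3; simp [Wd.N] at h3
      | zero => rw [hw] at h3; simp [Wd.N] at h3
    choose v hv using this
    have e : w = Fin.cons (w 0) (fun i => reg (v i)) := by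
      ext j; refine Fin.cases rfl (fun j => ?_) j
      rw [hv, Fin.cons_succ]
    rw [e]
    exact F_zero_aux D hCH _ _

include hCH in
lemma kill : ∀ {m : ℕ} (w : Fin m → Wd R) (σ : Perm (Fin m)) (P : Finset (Fin m)), P.card = n + 1 →
    ∑ h : Perm (Fin m), alt K P h • T (tt D) m w (σ * h) = 0
  | 0, w, σ, P, hP => by
      have : P.card ≤ 0 := by simpa using Finset.card_le_univ P
      omega
  | m+1, w, σ, P, hP => by
      classical
      by_cases hu : P = Finset.univ
      · have hm : m = n := by
          rw [hu, Finset.card_univ, Fintype.card_fin] at hP; omega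
        subst hm
        have h1 := F_zero D hCH w
        rw [F, ← Equiv.sum_comp (Equiv.mulLeft σ)] at h1
        have h2 : (Perm.sign σ : ℤ) • ∑ h : Perm (Fin (m+1)), alt K P h • T (tt D) (m+1) w (σ * h) = 0 := by
          rw [← h1, Finset.smul_sum]
          refine Finset.sum_congr rfl fun h _ => ?_
          have h3 : alt K P h = ((Perm.sign h : ℤ) : K) := by
            rw [alt, if_pos]; intro x hx; exact absurd (by simp [hu]) hx
          rw [h3, Int.cast_smul_eq_zsmul, smul_smul]
          simp
        rcases Int.units_eq_one_or (Perm.sign σ) with h | h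
        · simpa [h] using h2
        · simpa [h] using h2
      · -- reduce to the case where zero is outside `P`
        have main : ∀ (w : Fin (m+1) → Wd R) (σ : Perm (Fin (m+1))) (P : Finset (Fin (m+1))),
            P.card = n + 1 → 0 ∉ P →
            ∑ h : Perm (Fin (m+1)), alt K P h • T (tt D) (m+1) w (σ * h) = 0 := by
          intro w σ P hP h0
          let P0 : Finset (Fin m) := P.preimage Fin.succ (Fin.succ_injective m).injOn
          have hP0 : P0.card = n + 1 := by
            rw [← hP, Finset.card_preimage, Finset.filter_true_of_mem]
            intro x hx
            obtain ⟨y, rfl⟩ := Fin.exists_succ_eq.2 (show x ≠ 0 by rintro rfl; exact h0 hx)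
            exact ⟨y, rfl⟩
          have ha : ∀ p (h : Perm (Fin m)), alt K P (ins p h) = if p = 0 then alt K P0 h else 0 := by
            intro p h
            split_ifs with hp
            · subst hp
              have e : (∀ x, x ∉ P → ins 0 h x = x) ↔ (∀ x, x ∉ P0 → h x = x) := by
                constructor
                · intro H x hx
                  have := H x.succ (by simpa [P0] using hx)
                  simpa [ins_succ] using this
                · intro H x hx
                  obtain rfl | ⟨x, rfl⟩ := Fin.eq_zero_or_eq_succ x
                  · rw [ins_zero]
                  · have := H x (by simpa [P0] using hx)
                    simp [ins_succ, this]
              simp only [alt, e, sign_ins]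
              simp
            · rw [alt, if_neg]
              intro H
              have := H 0 h0
              rw [ins_zero] at this
              exact hp this
          obtain ⟨p, τ, rfl⟩ := exists_ins σ
          rw [sum_ins, Fin.sum_univ_succ]
          simp only [ha, ins_mul, Fin.succ_ne_zero, if_false, if_true, zero_smul,
            Finset.sum_const_zero, add_zero]
          obtain rfl | ⟨k, rfl⟩ := Fin.eq_zero_or_eq_succ p
          · simp only [T_ins_zero, ← mul_smul_comm]
            rw [← Finset.mul_sum, kill _ τ P0 hP0, mul_zero]
          · simp only [T_ins_succ]
            exact kill _ τ P0 hP0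
        obtain ⟨x, hx⟩ : ∃ x, x ∉ P := by
          by_contra hc; push Not at hc; exact hu (by ext x; simp [hc x])
        have h1 := main (w ∘ swap 0 x) ((swap 0 x)⁻¹ * σ * swap 0 x) (P.map (swap 0 x).toEmbedding)
          (by rw [Finset.card_map, hP]) (by
            intro h
            rw [Finset.mem_map] at h
            obtain ⟨y, hy, h⟩ := h
            rw [Equiv.coe_toEmbedding, swap_apply_eq_iff, swap_apply_left] at h
            exact hx (h ▸ hy))
        rw [← Equiv.sum_comp (MulAut.conj (swap 0 x)⁻¹).toEquiv] at h1
        rw [← h1]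
        refine Finset.sum_congr rfl fun h _ => ?_
        have e1 : (MulAut.conj (swap 0 x)⁻¹).toEquiv h = (swap 0 x)⁻¹ * h * swap 0 x := by simp
        rw [e1]
        have e2 : (swap 0 x)⁻¹ * σ * swap 0 x * ((swap 0 x)⁻¹ * h * swap 0 x)
            = (swap 0 x)⁻¹ * (σ * h) * swap 0 x := by group
        rw [e2, T_conj _ (tt_mul_comm D) (tt_comm D)]
        congr 1
        have e3 : (∀ y, y ∉ P.map (swap 0 x).toEmbedding → ((swap 0 x)⁻¹ * h * swap 0 x) y = y) ↔
            (∀ y, y ∉ P → h y = y) := by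
          constructor
          · intro H y hy
            have := H (swap 0 x y) (by
              rw [Finset.mem_map]; rintro ⟨z, hz, hz'⟩
              rw [Equiv.coe_toEmbedding] at hz'
              exact hy ((swap 0 x).injective hz' ▸ hz))
            simp only [Perm.mul_apply, swap_inv, swap_apply_self] at this
            exact (swap 0 x).injective this
          · intro H y hy
            have := H (swap 0 x y) (by
              intro hz; apply hy; rw [Finset.mem_map]
              exact ⟨_, hz, by simp⟩)
            simp only [Perm.mul_apply, swap_inv, this, swap_apply_self]
        have e4 : Perm.sign ((swap 0 x)⁻¹ * h * swap 0 x) = Perm.sign h := by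
          rw [Perm.sign_mul, Perm.sign_mul, Perm.sign_inv, mul_right_comm, Int.units_mul_self, one_mul]
        simp only [alt, e3, e4]

include hCH in
theorem uniq {m : ℕ} (w : Fin m → Wd R) (b : Perm (Fin m) → K)
    (h : ∀ τ, ∑ σ, b σ * G K n σ τ = 0) : ∑ σ, b σ • T (tt D) m w σ = 0 :=
  straighten (n := n) (T (tt D) m w) (fun σ P hP => kill D hCH w σ P hP) b (gram b h)

end Main
end CHProof

namespace CHProof
open Equiv Equiv.Perm Wd

set_option linter.unusedSimpArgs false
set_option linter.unusedVariables false
set_option linter.unusedSectionVars false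

section Psi
variable {K : Type} [Field K] [CharZero K] {R : Type} [Ring R] [Algebra K R] (D : TraceData K R)
variable {n : ℕ}

lemma sum_cons {m : ℕ} {A : Type} [AddCommMonoid A] (f : (Fin (m+1) → Fin n) → A) :
    ∑ c, f c = ∑ k, ∑ c : Fin m → Fin n, f (Fin.cons k c) := by
  rw [← Fintype.sum_prod_type', ← Equiv.sum_comp (Fin.consEquiv fun _ => Fin n)]
  rfl

/-- matching indicator -/
def mt (K : Type) [Field K] {m : ℕ} (i j : Fin m → Fin n) (τ : Perm (Fin m)) : K :=
  if j = i ∘ τ then 1 else 0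

def np (K : Type) [Field K] (n : ℕ) {m : ℕ} (p : Fin (m+1)) : K := if p = 0 then (n : K) else 1

lemma mt_cons {m : ℕ} (i j : Fin m → Fin n) (p : Fin (m+1)) (ρ : Perm (Fin m)) :
    ∑ k, mt K (Fin.cons k i : Fin (m+1) → Fin n) (Fin.cons k j) (ins p ρ) = np K n p * mt K i j ρ := by
  obtain rfl | ⟨q, rfl⟩ := Fin.eq_zero_or_eq_succ p
  · have : ∀ k, mt K (Fin.cons k i : Fin (m+1) → Fin n) (Fin.cons k j) (ins 0 ρ) = mt K i j ρ := by
      intro k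
      have e : (Fin.cons k i : Fin (m+1) → Fin n) ∘ ins 0 ρ = Fin.cons k (i ∘ ρ) := by
        ext x; refine Fin.cases ?_ (fun x => ?_) x
        · simp [ins_zero]
        · simp [ins_succ]
      simp only [mt, e, Fin.cons_inj, true_and]
    simp [this, np]
  · have : ∀ k, mt K (Fin.cons k i : Fin (m+1) → Fin n) (Fin.cons k j) (ins q.succ ρ)
        = if k = i q then mt K i j ρ else 0 := by
      intro k
      have e : ((Fin.cons k j : Fin (m+1) → Fin n) = (Fin.cons k i : Fin (m+1) → Fin n) ∘ ins q.succ ρ)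
          ↔ (k = i q ∧ j = i ∘ ρ) := by
        constructor
        · intro h
          have h0 : k = i q := by simpa [ins_zero] using congrFun h 0
          refine ⟨h0, ?_⟩
          ext x
          have := congrFun h x.succ
          simp only [Fin.cons_succ, Function.comp, ins_succ, Fin.succ_inj] at this
          rw [this]
          split_ifs with hx
          · simp [h0, hx]
          · rfl
        · rintro ⟨h0, h1⟩
          ext x; refine Fin.cases ?_ (fun x => ?_) x
          · simp [ins_zero, h0]
          · simp only [Fin.cons_succ, Function.comp, ins_succ, Fin.succ_inj]
            split_ifs with hx
            · simp [h0, h1, hx]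
            · simp [h1]
      simp only [mt, e]
      split_ifs <;> simp_all
    simp [this, np]

lemma G_eq_mt {m : ℕ} (σ τ : Perm (Fin m)) : G K n σ τ = ∑ c : Fin m → Fin n, mt K c (c ∘ σ) τ := by
  simp only [G, mt, eq_comm]

lemma G_ins {m : ℕ} (p : Fin (m+1)) (σ ρ : Perm (Fin m)) :
    G K n (ins 0 σ) (ins p ρ) = np K n p * G K n σ ρ := by
  rw [G_eq_mt, G_eq_mt, sum_cons, Finset.sum_comm, Finset.mul_sum]
  refine Finset.sum_congr rfl fun c _ => ?_
  rw [← mt_cons]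
  refine Finset.sum_congr rfl fun k _ => ?_
  congr 1
  ext x; refine Fin.cases ?_ (fun x => ?_) x
  · simp [ins_zero]
  · simp [ins_succ]

lemma G_ins' {m : ℕ} (p : Fin (m+1)) (σ ρ : Perm (Fin m)) :
    G K n (ins p ρ) (ins 0 σ) = np K n p * G K n ρ σ := by
  rw [G_symm, G_ins, G_symm]

lemma mt_mul {m : ℕ} (π τ : Perm (Fin m)) (i j : Fin m → Fin n) : mt K i j (π * τ) = mt K (i ∘ π) j τ := by
  have : (j = i ∘ ⇑(π * τ)) ↔ j = (i ∘ π) ∘ τ := by rw [Perm.coe_mul, Function.comp_assoc]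
  simp only [mt, this]

lemma G_mul_left {m : ℕ} (π σ τ : Perm (Fin m)) : G K n (π * σ) τ = G K n σ (π⁻¹ * τ) := by
  rw [G_eq_mt, G_eq_mt, ← Equiv.sum_comp (Equiv.arrowCongr π (Equiv.refl (Fin n)))]
  symm
  refine Finset.sum_congr rfl fun c _ => ?_
  rw [mt_mul]
  have e1 : (Equiv.arrowCongr π (Equiv.refl (Fin n))) c = c ∘ ⇑π⁻¹ := rfl
  have e2 : (c ∘ ⇑π⁻¹) ∘ ⇑(π * σ) = c ∘ ⇑σ := by ext; simp
  rw [e1, e2]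

lemma G_conj {m : ℕ} (π σ τ : Perm (Fin m)) : G K n (π⁻¹ * σ * π) (π⁻¹ * τ * π) = G K n σ τ := by
  rw [mul_assoc, mul_assoc, G_mul_left]
  simp only [G, inv_inv, mul_inv_cancel_left]
  refine Finset.sum_congr rfl fun c _ => ?_
  have : (c ∘ ⇑(τ * π) = c ∘ ⇑(σ * π)) ↔ (c ∘ τ = c ∘ σ) := by
    simp only [Perm.coe_mul, ← Function.comp_assoc]
    exact π.surjective.injective_comp_right.eq_iff
  simp only [this]

lemma mt_conj {m : ℕ} (π τ : Perm (Fin m)) (i j : Fin m → Fin n) :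
    mt K (i ∘ π) (j ∘ π) (π⁻¹ * τ * π) = mt K i j τ := by
  have : (j ∘ π = (i ∘ π) ∘ ⇑(π⁻¹ * τ * π)) ↔ j = i ∘ τ := by
    rw [← π.surjective.injective_comp_right.eq_iff (a := j)]
    have : (i ∘ π) ∘ ⇑(π⁻¹ * τ * π) = (i ∘ τ) ∘ π := by ext; simp
    rw [this]
  simp only [mt, this]

lemma coeff_ex (K : Type) [Field K] [CharZero K] {m : ℕ} (i j : Fin m → Fin n) :
    ∃ a : Perm (Fin m) → K, ∀ τ, ∑ σ, a σ * G K n σ τ = mt K i j τ := by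
  apply exists_coeff
  intro b hb
  rw [← hb i j, Pm]
  refine Finset.sum_congr rfl fun σ _ => ?_
  simp [mt]

/-- coefficients of a monomial functional -/
noncomputable def cf (K : Type) [Field K] [CharZero K] {m : ℕ} (i j : Fin m → Fin n) : Perm (Fin m) → K :=
  (coeff_ex K i j).choose

lemma cf_spec {m : ℕ} (i j : Fin m → Fin n) (τ : Perm (Fin m)) :
    ∑ σ, cf K i j σ * G K n σ τ = mt K i j τ := (coeff_ex K i j).choose_spec τ

noncomputable def Psi {m : ℕ} (w : Fin m → Wd R) (i j : Fin m → Fin n) : Cf R :=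
  ∑ σ, cf K i j σ • T (tt D) m w σ

variable (hCH : IsCayleyHamilton D n)

include hCH in
lemma uniq2 {m : ℕ} (w : Fin m → Wd R) (a b : Perm (Fin m) → K)
    (h : ∀ τ, ∑ σ, a σ * G K n σ τ = ∑ σ, b σ * G K n σ τ) :
    ∑ σ, a σ • T (tt D) m w σ = ∑ σ, b σ • T (tt D) m w σ := by
  have := uniq D hCH w (fun σ => a σ - b σ) (fun τ => by
    simp only [sub_mul, Finset.sum_sub_distrib, h, sub_self])
  simp only [sub_smul, Finset.sum_sub_distrib] at this
  exact sub_eq_zero.1 this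

include hCH in
lemma Psi_perm {m : ℕ} (π : Perm (Fin m)) (w : Fin m → Wd R) (i j : Fin m → Fin n) :
    Psi D (w ∘ π) (i ∘ π) (j ∘ π) = Psi D w i j := by
  have e1 : ∀ σ, (MulAut.conj π⁻¹).toEquiv σ = π⁻¹ * σ * π := by intro σ; simp
  have : Psi D (w ∘ π) (i ∘ π) (j ∘ π) = ∑ σ, cf K (i ∘ π) (j ∘ π) (π⁻¹ * σ * π) • T (tt D) m w σ := by
    rw [Psi, ← Equiv.sum_comp (MulAut.conj π⁻¹).toEquiv]
    simp only [e1, T_conj _ (tt_mul_comm D) (tt_comm D)]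
  rw [this, Psi]
  apply uniq2 D hCH
  intro τ
  rw [cf_spec, ← mt_conj π, ← cf_spec, ← Equiv.sum_comp (MulAut.conj π⁻¹).toEquiv (fun σ => cf K (i ∘ π) (j ∘ π) σ * _)]
  simp only [e1, G_conj]

include hCH in
lemma Psi_sum {m : ℕ} (w : Fin m → Wd R) (σ : Perm (Fin m)) :
    ∑ c : Fin m → Fin n, Psi D w c (c ∘ σ) = T (tt D) m w σ := by
  have h := uniq2 D hCH w (fun ρ => ∑ c : Fin m → Fin n, cf K c (c ∘ σ) ρ) (fun ρ => if ρ = σ then 1 else 0)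
    (fun τ => by
      simp only [Finset.sum_mul]
      rw [Finset.sum_comm]
      simp only [cf_spec]
      simp [G_eq_mt])
  simp only [Finset.sum_smul] at h
  rw [Finset.sum_comm] at h
  simpa [Psi] using h

include hCH in
lemma Psi_trace {m : ℕ} (x : Wd R) (w : Fin m → Wd R) (i j : Fin m → Fin n) :
    ∑ k : Fin n, Psi D (Fin.cons x w : Fin (m+1) → Wd R) (Fin.cons k i) (Fin.cons k j)
      = tt D x * Psi D w i j := by
  have h := uniq2 D hCH (Fin.cons x w : Fin (m+1) → Wd R)
    (fun σ => ∑ k : Fin n, cf K (Fin.cons k i : Fin (m+1) → Fin n) (Fin.cons k j) σ)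
    (fun σ => if (decomposeFin σ).1 = 0 then cf K i j (decomposeFin σ).2 else 0)
    (fun τ => by
      obtain ⟨p, ρ, rfl⟩ := exists_ins τ
      simp only [Finset.sum_mul]
      rw [Finset.sum_comm]
      simp only [cf_spec]
      rw [mt_cons, ← cf_spec, sum_ins, Fin.sum_univ_succ]
      simp only [ins, Equiv.apply_symm_apply, if_true, Fin.succ_ne_zero, if_false, zero_mul,
        Finset.sum_const_zero, add_zero]
      rw [Finset.mul_sum]
      refine Finset.sum_congr rfl fun σ _ => ?_
      have := G_ins (K := K) (n := n) p σ ρ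
      simp only [ins] at this
      rw [this]; ring)
  simp only [Finset.sum_smul] at h
  rw [Finset.sum_comm] at h
  simp only [Psi]
  rw [h, sum_ins, Fin.sum_univ_succ]
  have e : ∀ (p : Fin (m+1)) (ρ : Perm (Fin m)), decomposeFin (ins p ρ) = (p, ρ) := by
    intro p ρ; simp [ins]
  simp only [e, if_true, Fin.succ_ne_zero, if_false, zero_smul, Finset.sum_const_zero, add_zero,
    T_ins_zero, Fin.cons_zero, Fin.tail_cons, Finset.mul_sum, mul_smul_comm]

include hCH in
lemma Psi_one {m : ℕ} (w : Fin m → Wd R) (i0 j0 : Fin n) (i j : Fin m → Fin n) :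
    Psi D (Fin.cons 1 w : Fin (m+1) → Wd R) (Fin.cons i0 i) (Fin.cons j0 j)
      = if i0 = j0 then Psi D w i j else 0 := by
  have h1 : Psi D (Fin.cons 1 w : Fin (m+1) → Wd R) (Fin.cons i0 i) (Fin.cons j0 j)
      = ∑ τ, (∑ p, np K n p * cf K (Fin.cons i0 i : Fin (m+1) → Fin n) (Fin.cons j0 j) (ins p τ)) •
          T (tt D) m w τ := by
    rw [Psi, sum_ins, Finset.sum_comm]
    refine Finset.sum_congr rfl fun τ _ => ?_
    rw [Finset.sum_smul]
    refine Finset.sum_congr rfl fun p _ => ?_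
    obtain rfl | ⟨k, rfl⟩ := Fin.eq_zero_or_eq_succ p
    · rw [T_ins_zero, Fin.cons_zero, Fin.tail_cons, Wd.one_def, tt_reg, hCH.1, mul_comm, mul_smul]
      congr 1
      simp [np, Nat.cast_smul_eq_nsmul]
    · rw [T_ins_succ, Fin.cons_zero, Fin.tail_cons, one_mul, Fin.cons_succ, Function.update_eq_self]
      simp [np, Fin.succ_ne_zero]
  have h2 : (if i0 = j0 then Psi D w i j else 0)
      = ∑ τ, (if i0 = j0 then cf K i j τ else 0) • T (tt D) m w τ := by
    split_ifs
    · rfl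
    · simp
  rw [h1, h2]
  apply uniq2 D hCH
  intro ρ
  have h3 : ∑ τ, (∑ p, np K n p * cf K (Fin.cons i0 i : Fin (m+1) → Fin n) (Fin.cons j0 j) (ins p τ))
      * G K n τ ρ = mt K (Fin.cons i0 i : Fin (m+1) → Fin n) (Fin.cons j0 j) (ins 0 ρ) := by
    rw [← cf_spec, sum_ins, Finset.sum_comm]
    refine Finset.sum_congr rfl fun τ _ => ?_
    rw [Finset.sum_mul]
    refine Finset.sum_congr rfl fun p _ => ?_
    rw [G_ins']; ring
  rw [h3]
  have h4 : ∑ τ, (if i0 = j0 then cf K i j τ else 0) * G K n τ ρ = if i0 = j0 then mt K i j ρ else 0 := by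
    split_ifs
    · exact cf_spec _ _ _
    · simp
  rw [h4]
  have e : (Fin.cons i0 i : Fin (m+1) → Fin n) ∘ ins 0 ρ = Fin.cons i0 (i ∘ ρ) := by
    ext x; refine Fin.cases ?_ (fun x => ?_) x
    · simp [ins_zero]
    · simp [ins_succ]
  simp only [mt, e, Fin.cons_inj]
  by_cases h : i0 = j0
  · simp [h]
  · simp [h, Ne.symm h]

include hCH in
lemma Psi_mul {m : ℕ} (x y : Wd R) (w : Fin m → Wd R) (i0 j0 : Fin n) (i j : Fin m → Fin n) :
    ∑ k, Psi D (Fin.cons x (Fin.cons y w : Fin (m+1) → Wd R) : Fin (m+2) → Wd R)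
        (Fin.cons i0 (Fin.cons k i : Fin (m+1) → Fin n)) (Fin.cons k (Fin.cons j0 j : Fin (m+1) → Fin n))
      = Psi D (Fin.cons (x * y) w : Fin (m+1) → Wd R) (Fin.cons i0 i) (Fin.cons j0 j) := by
  have e : ∀ (p : Fin (m+2)) (ρ : Perm (Fin (m+1))), decomposeFin (ins p ρ) = (p, ρ) := by
    intro p ρ; simp [ins]
  set z : Fin (m+2) := Fin.succ 0 with hz
  have h := uniq2 D hCH (Fin.cons x (Fin.cons y w : Fin (m+1) → Wd R) : Fin (m+2) → Wd R)
    (fun σ => ∑ k : Fin n, cf K (Fin.cons i0 (Fin.cons k i : Fin (m+1) → Fin n) : Fin (m+2) → Fin n)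
      (Fin.cons k (Fin.cons j0 j : Fin (m+1) → Fin n)) σ)
    (fun σ => if (decomposeFin σ).1 = z then
      cf K (Fin.cons i0 i : Fin (m+1) → Fin n) (Fin.cons j0 j) (decomposeFin σ).2 else 0)
    (fun τ => by
      simp only [Finset.sum_mul]
      rw [Finset.sum_comm]
      simp only [cf_spec]
      obtain ⟨p, ρ, hτ⟩ := exists_ins (swap 0 z * τ)
      have hτ2 : τ = swap 0 z * ins p ρ := by rw [← hτ, ← mul_assoc, swap_mul_self, one_mul]
      rw [hτ2]
      simp only [mt_mul]
      have e2 : ∀ k, (Fin.cons i0 (Fin.cons k i : Fin (m+1) → Fin n) : Fin (m+2) → Fin n) ∘ swap 0 z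
          = Fin.cons k (Fin.cons i0 i : Fin (m+1) → Fin n) := by
        intro k
        ext t
        refine Fin.cases ?_ (fun t => ?_) t
        · simp only [Function.comp, swap_apply_left, hz, Fin.cons_succ, Fin.cons_zero]
        · refine Fin.cases ?_ (fun t => ?_) t
          · rw [← hz]; simp only [Function.comp, swap_apply_right, Fin.cons_zero]
            rw [hz]; simp only [Fin.cons_succ, Fin.cons_zero]
          · simp only [Function.comp]
            rw [swap_apply_of_ne_of_ne (Fin.succ_ne_zero _)
              (fun h => Fin.succ_ne_zero _ (Fin.succ_injective _ h))]
            simp only [Fin.cons_succ]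
      simp only [e2]
      rw [mt_cons, ← cf_spec]
      conv_rhs => rw [sum_ins]
      rw [Finset.sum_eq_single z]
      · rw [Finset.mul_sum]
        refine Finset.sum_congr rfl fun σ _ => ?_
        have e3 : ins z σ = swap 0 z * ins 0 σ := by
          have : Equiv.swap 0 z = ins z 1 := by simp [ins]
          rw [this, ins_mul, one_mul]
        simp only [e, if_true]
        rw [e3, G_mul_left, inv_mul_cancel_left, G_ins]; ring
      · intro q _ hq
        simp [e, hq]
      · simp)
  simp only [Finset.sum_smul] at h
  rw [Finset.sum_comm] at h
  simp only [Psi]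
  rw [h, sum_ins, Finset.sum_eq_single z]
  · refine Finset.sum_congr rfl fun σ _ => ?_
    simp only [e, if_true]
    rw [hz, T_ins_succ, Fin.tail_cons, Fin.cons_zero, Fin.cons_succ, Fin.cons_zero, Fin.update_cons_zero]
  · intro q _ hq
    simp [e, hq]
  · simp

lemma Psi_lin {m : ℕ} (w : Fin m → Wd R) (i j : Fin (m+1) → Fin n) (k : K) (r s : R) :
    Psi D (Fin.cons (reg (k • r + s)) w : Fin (m+1) → Wd R) i j
      = k • Psi D (Fin.cons (reg r) w : Fin (m+1) → Wd R) i j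
        + Psi D (Fin.cons (reg s) w : Fin (m+1) → Wd R) i j := by
  simp only [Psi, Finset.smul_sum, ← Finset.sum_add_distrib]
  refine Finset.sum_congr rfl fun σ _ => ?_
  have := T_reg_lin D (Fin.cons 1 w : Fin (m+1) → Wd R) 0 k r s σ
  simp only [Fin.update_cons_zero] at this
  rw [this, smul_add, smul_comm]

include hCH in
lemma Psi_Tr {m : ℕ} (w : Fin m → Wd R) (i0 j0 : Fin n) (i j : Fin m → Fin n) (r : R) :
    Psi D (Fin.cons (reg (D.Tr r)) w : Fin (m+1) → Wd R) (Fin.cons i0 i) (Fin.cons j0 j)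
      = if i0 = j0 then ∑ k : Fin n, Psi D (Fin.cons (reg r) w : Fin (m+1) → Wd R)
          (Fin.cons k i) (Fin.cons k j) else 0 := by
  have h1 : Psi D (Fin.cons (reg (D.Tr r)) w : Fin (m+1) → Wd R) (Fin.cons i0 i) (Fin.cons j0 j)
      = tt D (reg r) * Psi D (Fin.cons 1 w : Fin (m+1) → Wd R) (Fin.cons i0 i) (Fin.cons j0 j) := by
    simp only [Psi, Finset.mul_sum]
    refine Finset.sum_congr rfl fun σ _ => ?_
    have := T_lin (tt D) (tt D (reg r)) 0 (fun x => tt_comm D _ _) (fun x => Commute.zero_left _)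
      (Fin.cons 1 w : Fin (m+1) → Wd R) 0 (reg (D.Tr r)) 1 1 (fun u v => by
        rw [zero_mul, add_zero, mul_one]
        cases u <;> cases v
        case reg.reg a b =>
          simp only [reg_mul_reg, tt_reg, ← TrivSqZeroExt.inl_mul]
          rw [← D.central, mul_assoc, D.trace_trace]
        case reg.spec a b c =>
          ext
          · simp
          · simp
            rw [← D.central r a]
            simp only [← mul_assoc]
            rw [D.central r c]
        case spec.reg a b c =>
          ext
          · simp
          · simp
            rw [← D.central r b]
            simp only [mul_assoc]
        all_goals simp) σ
    simp only [Fin.update_cons_zero, zero_mul, add_zero] at this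
    rw [this, mul_smul_comm]
  rw [h1, Psi_one D hCH]
  split_ifs
  · rw [Psi_trace D hCH]
  · rw [mul_zero]

end Psi
end CHProof

namespace CHProof
open Equiv Equiv.Perm Wd

set_option linter.unusedSimpArgs false
set_option linter.unusedVariables false
set_option linter.unusedSectionVars false

lemma exists_perm {X : Type} : ∀ (m : ℕ) (w w' : Fin m → X), List.Perm (List.ofFn w) (List.ofFn w') →
    ∃ π : Perm (Fin m), w' = w ∘ π := by
  intro m
  induction m with
  | zero => intro w w' _; exact ⟨1, by ext x; exact x.elim0⟩
  | succ m ih =>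
    intro w w' h
    have h0 : w' 0 ∈ List.ofFn w := h.mem_iff.2 (List.mem_ofFn' _ _ |>.2 ⟨0, rfl⟩)
    obtain ⟨p, hp⟩ := (List.mem_ofFn' _ _).1 h0
    have h1 : List.Perm (List.ofFn (w ∘ swap 0 p)) (List.ofFn w') :=
      (Equiv.Perm.ofFn_comp_perm (swap 0 p) w).trans h
    rw [List.ofFn_succ, List.ofFn_succ (f := w')] at h1
    have h2 : (w ∘ swap 0 p) 0 = w' 0 := by simp [hp]
    rw [h2, List.perm_cons] at h1
    obtain ⟨π, hπ⟩ := ih _ _ h1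
    refine ⟨swap 0 p * ins 0 π, ?_⟩
    ext x
    refine Fin.cases ?_ (fun x => ?_) x
    · simp [ins_zero, hp]
    · have := congrFun hπ x
      simpa [ins_succ] using this

section PsiM
variable {K : Type} [Field K] [CharZero K] {R : Type} [Ring R] [Algebra K R] (D : TraceData K R)
variable {n : ℕ}

noncomputable def PsiX {m : ℕ} (w : Fin m → Wd R × Fin n × Fin n) : Cf R :=
  Psi D (fun t => (w t).1) (fun t => (w t).2.1) (fun t => (w t).2.2)

lemma comp_cons {X Y : Type} {m : ℕ} (f : X → Y) (a : X) (w : Fin m → X) :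
    (fun t => f ((Fin.cons a w : Fin (m+1) → X) t)) = (Fin.cons (f a) (fun t => f (w t)) : Fin (m+1) → Y) := by
  ext t; refine Fin.cases ?_ (fun t => ?_) t <;> simp

lemma PsiX_cons {m : ℕ} (x : Wd R) (i j : Fin n) (w : Fin m → Wd R × Fin n × Fin n) :
    PsiX D (Fin.cons (x, i, j) w : Fin (m+1) → Wd R × Fin n × Fin n) =
      Psi D (Fin.cons x (fun t => (w t).1) : Fin (m+1) → Wd R) (Fin.cons i (fun t => (w t).2.1))
        (Fin.cons j (fun t => (w t).2.2)) := by
  rw [PsiX, comp_cons (fun y : Wd R × Fin n × Fin n => y.1), comp_cons (fun y : Wd R × Fin n × Fin n => y.2.1),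
    comp_cons (fun y : Wd R × Fin n × Fin n => y.2.2)]

noncomputable def PsiL (l : List (Wd R × Fin n × Fin n)) : Cf R := PsiX D l.get

lemma PsiL_eq {m : ℕ} (w : Fin m → Wd R × Fin n × Fin n) (l : List (Wd R × Fin n × Fin n))
    (h : l = List.ofFn w) : PsiL D l = PsiX D w := by
  have hm : m = l.length := by simp [h]
  subst hm
  have : l.get = w := by
    apply List.ofFn_injective
    rw [← h, List.ofFn_get]
  rw [PsiL, this]

variable (hCH : IsCayleyHamilton D n)

include hCH in
lemma PsiL_perm (l l' : List (Wd R × Fin n × Fin n)) (h : List.Perm l l') : PsiL D l = PsiL D l' := by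
  obtain ⟨w', hw'⟩ : ∃ w' : Fin l.length → Wd R × Fin n × Fin n, l' = List.ofFn w' := by
    rw [h.length_eq]
    exact ⟨l'.get, (List.ofFn_get _).symm⟩
  obtain ⟨π, hπ⟩ := exists_perm _ l.get w' (by rw [List.ofFn_get, ← hw']; exact h)
  rw [PsiL_eq D w' l' hw', hπ, PsiL]
  exact (Psi_perm D hCH π _ _ _).symm

noncomputable def PsiM (s : Multiset (Wd R × Fin n × Fin n)) : Cf R :=
  Quotient.liftOn s (PsiL D) (PsiL_perm D hCH)

lemma PsiM_coe {m : ℕ} (w : Fin m → Wd R × Fin n × Fin n) : PsiM D hCH (List.ofFn w : List _) = PsiX D w :=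
  PsiL_eq D w _ rfl

lemma cons_coe {X : Type} {m : ℕ} (x : X) (w : Fin m → X) :
    x ::ₘ ((List.ofFn w : List X) : Multiset X) = (List.ofFn (Fin.cons x w : Fin (m+1) → X) : List X) := by
  rw [List.ofFn_cons]; rfl

lemma exists_fn {X : Type} (s : Multiset X) : ∃ (m : ℕ) (w : Fin m → X), s = (List.ofFn w : List X) := by
  induction s using Quotient.inductionOn with
  | h l => exact ⟨l.length, l.get, by rw [List.ofFn_get]; rfl⟩

lemma PsiM_one (i j : Fin n) (s : Multiset (Wd R × Fin n × Fin n)) :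
    PsiM D hCH ((1, i, j) ::ₘ s) = if i = j then PsiM D hCH s else 0 := by
  obtain ⟨m, w, rfl⟩ := exists_fn s
  rw [cons_coe, PsiM_coe, PsiM_coe, PsiX_cons, Psi_one D hCH]; rfl

lemma PsiM_mul (x y : Wd R) (i j : Fin n) (s : Multiset (Wd R × Fin n × Fin n)) :
    ∑ k, PsiM D hCH ((x, i, k) ::ₘ (y, k, j) ::ₘ s) = PsiM D hCH ((x * y, i, j) ::ₘ s) := by
  obtain ⟨m, w, rfl⟩ := exists_fn s
  simp only [cons_coe, PsiM_coe, PsiX_cons]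
  rw [← Psi_mul D hCH]
  refine Finset.sum_congr rfl fun k _ => ?_
  rw [comp_cons (fun y : Wd R × Fin n × Fin n => y.1), comp_cons (fun y : Wd R × Fin n × Fin n => y.2.1),
    comp_cons (fun y : Wd R × Fin n × Fin n => y.2.2)]

lemma PsiM_lin (k : K) (r r' : R) (i j : Fin n) (s : Multiset (Wd R × Fin n × Fin n)) :
    PsiM D hCH ((reg (k • r + r'), i, j) ::ₘ s) =
      k • PsiM D hCH ((reg r, i, j) ::ₘ s) + PsiM D hCH ((reg r', i, j) ::ₘ s) := by
  obtain ⟨m, w, rfl⟩ := exists_fn s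
  simp only [cons_coe, PsiM_coe, PsiX_cons]
  rw [Psi_lin]

lemma PsiM_Tr (r : R) (i j : Fin n) (s : Multiset (Wd R × Fin n × Fin n)) :
    PsiM D hCH ((reg (D.Tr r), i, j) ::ₘ s) =
      if i = j then ∑ k, PsiM D hCH ((reg r, k, k) ::ₘ s) else 0 := by
  obtain ⟨m, w, rfl⟩ := exists_fn s
  simp only [cons_coe, PsiM_coe, PsiX_cons]
  rw [Psi_Tr D hCH]

lemma PsiM_final (r : R) :
    ∑ a : Fin n, ∑ b : Fin n, PsiM D hCH ((reg r, b, a) ::ₘ {((spec 1 1 : Wd R), a, b)})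
      = TrivSqZeroExt.inr r := by
  have h := Psi_sum D hCH (Fin.cons (reg r) (Fin.cons (spec 1 1) Fin.elim0 : Fin 1 → Wd R) : Fin 2 → Wd R) 
    (ins (Fin.succ 0) (ins 0 1))
  rw [T_ins_succ, T_ins_zero, sum_cons] at h
  simp only [sum_cons (m := 0)] at h
  have e : ∀ (a b : Fin n), PsiM D hCH ((reg r, b, a) ::ₘ {((spec 1 1 : Wd R), a, b)}) =
     PsiX D (Fin.cons (reg r, b, a) (Fin.cons (spec 1 1, a, b) Fin.elim0 : Fin 1 → Wd R × Fin n × Fin n) : Fin 2 → _) := by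
    intro a b
    rw [← PsiM_coe D hCH]
    congr 1
  simp only [e, PsiX_cons]
  rw [Finset.sum_comm]
  have h5 : (Fin.cons (reg r) (Fin.cons (spec 1 1) Fin.elim0 : Fin 1 → Wd R) : Fin 2 → Wd R) 0 * 
    (Fin.cons (reg r) (Fin.cons (spec 1 1) Fin.elim0 : Fin 1 → Wd R) : Fin 2 → Wd R) (Fin.succ 0) = spec r 1 := by
    simp
  rw [h5, Function.update_self, tt_spec, one_mul] at h
  have h6 : ∀ w' : Fin 0 → Wd R, T (tt D) 0 w' 1 = 1 := fun _ => rfl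
  rw [h6, mul_one] at h
  rw [← h]
  refine Finset.sum_congr rfl fun y _ => Finset.sum_congr rfl fun x _ => ?_
  rw [Fintype.sum_unique]
  congr 1
  · ext t; fin_cases t <;> rfl
  · ext t; fin_cases t <;> rfl
  · ext t; fin_cases t <;> rfl

end PsiM

section Alg
variable {K : Type} [Field K] [CharZero K] {R : Type} [Ring R] [Algebra K R] (D : TraceData K R)
variable (n : ℕ)

abbrev Al (K R : Type) [Field K] (n : ℕ) : Type := AddMonoidAlgebra K (Multiset (R × Fin n × Fin n))

variable {n}

noncomputable def ev (K : Type) [Field K] (r : R) (i j : Fin n) : Al K R n := AddMonoidAlgebra.single {(r, i, j)} 1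

inductive Rl : Al K R n → Prop
  | lin (k : K) (r s : R) (i j : Fin n) : Rl (ev K (k • r + s) i j - (k • ev K r i j + ev K s i j))
  | one (i j : Fin n) : Rl (ev K 1 i j - if i = j then 1 else 0)
  | mul (r s : R) (i j : Fin n) : Rl (ev K (r * s) i j - ∑ k, ev K r i k * ev K s k j)
  | tr (r : R) (i j : Fin n) : Rl (ev K (D.Tr r) i j - if i = j then ∑ k, ev K r k k else 0)

noncomputable def JJ : Ideal (Al K R n) := Ideal.span {a | Rl D a}

variable (hCH : IsCayleyHamilton D n)

def ff (y : R × Fin n × Fin n) : Wd R × Fin n × Fin n := (reg y.1, y.2)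

noncomputable def psi (M : Multiset (Wd R × Fin n × Fin n)) : Al K R n →ₗ[K] Cf R :=
  (Finsupp.linearCombination K fun s => PsiM D hCH (s.map ff + M)) ∘ₗ
    (AddMonoidAlgebra.coeffLinearEquiv K).toLinearMap

lemma psi_single (M : Multiset (Wd R × Fin n × Fin n)) (s : Multiset (R × Fin n × Fin n)) (k : K) :
    psi D hCH M (AddMonoidAlgebra.single s k) = k • PsiM D hCH (s.map ff + M) := by
  simp [psi]

lemma psi_ev (M : Multiset (Wd R × Fin n × Fin n)) (r : R) (i j : Fin n) :
    psi D hCH M (ev K r i j) = PsiM D hCH ((reg r, i, j) ::ₘ M) := by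
  rw [ev, psi_single]; simp [ff]

lemma psi_mul (M : Multiset (Wd R × Fin n × Fin n)) (s : Multiset (R × Fin n × Fin n)) (k : K) (p : Al K R n) :
    psi D hCH M (AddMonoidAlgebra.single s k * p) = k • psi D hCH (s.map ff + M) p := by
  induction p using AddMonoidAlgebra.induction_linear with
  | zero => simp
  | add a b ha hb => rw [mul_add, map_add, map_add, ha, hb, smul_add]
  | single t l =>
    rw [AddMonoidAlgebra.single_mul_single, psi_single, psi_single, mul_smul, Multiset.map_add,
      add_comm (s.map ff), add_assoc]

lemma psi_rel (M : Multiset (Wd R × Fin n × Fin n)) (p : Al K R n) (hp : Rl D p) : psi D hCH M p = 0 := by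
  have h1 : psi D hCH M 1 = PsiM D hCH M := by
    rw [AddMonoidAlgebra.one_def, psi_single]; simp
  cases hp with
  | lin k r s i j =>
    simp only [map_sub, map_add, map_smul, psi_ev]
    rw [PsiM_lin, sub_self]
  | one i j =>
    rw [map_sub, psi_ev, ← Wd.one_def, PsiM_one]
    split_ifs <;> simp [h1]
  | mul r s i j =>
    rw [map_sub, psi_ev, ← reg_mul_reg, ← PsiM_mul, map_sum, sub_eq_zero]
    refine Finset.sum_congr rfl fun k _ => ?_
    nth_rw 1 [ev]
    rw [psi_mul, psi_ev, one_smul, Multiset.map_singleton, Multiset.singleton_add, Multiset.cons_swap]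
    rfl
  | tr r i j =>
    rw [map_sub, psi_ev, PsiM_Tr]
    split_ifs
    · simp only [map_sum, psi_ev, sub_self]
    · simp

lemma psi_JJ (M : Multiset (Wd R × Fin n × Fin n)) (p : Al K R n) (hp : p ∈ JJ D) : psi D hCH M p = 0 := by
  induction hp using Submodule.span_induction generalizing M with
  | mem x h => exact psi_rel D hCH M x h
  | zero => simp
  | add x y _ _ hx hy => rw [map_add, hx, hy, add_zero]
  | smul a x _ hx =>
    rw [smul_eq_mul]
    induction a using AddMonoidAlgebra.induction_linear with
    | zero => simp
    | add a b ha hb => rw [add_mul, map_add, ha, hb, add_zero]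
    | single s k => rw [psi_mul, hx, smul_zero]

end Alg

theorem main (K : Type) [Field K] [CharZero K] (R : Type) [Ring R] [Algebra K R]
    (D : TraceData K R) (n : ℕ) (hCH : IsCayleyHamilton D n) :
    ∃ (S : Type) (_ : CommRing S) (_ : Algebra K S) (ρ : R →ₐ[K] Matrix (Fin n) (Fin n) S),
      Function.Injective ρ ∧ ∀ a : R, ρ (D.Tr a) = Matrix.trace (ρ a) • (1 : Matrix (Fin n) (Fin n) S) := by
  let J : Ideal (Al K R n) := JJ D
  let q : Al K R n →ₐ[K] (Al K R n ⧸ J) := Ideal.Quotient.mkₐ K J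
  have hq : ∀ a b, Rl D (a - b) → q a = q b := by
    intro a b h
    exact Ideal.Quotient.eq.2 (Ideal.subset_span h)
  let M : R → Matrix (Fin n) (Fin n) (Al K R n ⧸ J) := fun r => Matrix.of fun i j => q (ev K r i j)
  have hlin : ∀ (k : K) r s, M (k • r + s) = k • M r + M s := by
    intro k r s; ext i j
    simpa [M] using hq _ _ (Rl.lin k r s i j)
  have hone : M 1 = 1 := by
    ext i j
    have := hq _ _ (Rl.one i j)
    simp only [M, Matrix.of_apply, this, Matrix.one_apply]
    split_ifs <;> simp
  have hmul : ∀ r s, M (r * s) = M r * M s := by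
    intro r s; ext i j
    simpa [M, Matrix.mul_apply] using hq _ _ (Rl.mul r s i j)
  have htr : ∀ r, M (D.Tr r) = Matrix.trace (M r) • (1 : Matrix (Fin n) (Fin n) (Al K R n ⧸ J)) := by
    intro r; ext i j
    have := hq _ _ (Rl.tr r i j)
    simp only [M, Matrix.of_apply, this, Matrix.smul_apply, Matrix.one_apply, Matrix.trace, Matrix.diag]
    split_ifs <;> simp
  have hzero : M 0 = 0 := by
    have := hlin 1 0 0
    simpa using this
  let L : R →ₗ[K] Matrix (Fin n) (Fin n) (Al K R n ⧸ J) :=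
    { toFun := M
      map_add' := fun r s => by simpa using hlin 1 r s
      map_smul' := fun k r => by simpa [hzero] using hlin k r 0 }
  refine ⟨Al K R n ⧸ J, inferInstance, inferInstance, AlgHom.ofLinearMap L hone hmul, ?_, htr⟩
  rw [injective_iff_map_eq_zero]
  intro r hr
  have hr' : ∀ i j, ev K r i j ∈ J := by
    intro i j
    have : M r i j = 0 := congrFun (congrFun hr i) j
    exact Ideal.Quotient.eq_zero_iff_mem.1 this
  have h := PsiM_final D hCH r
  have h2 : ∑ a : Fin n, ∑ b : Fin n, PsiM D hCH ((reg r, b, a) ::ₘ {((spec 1 1 : Wd R), a, b)}) = 0 := by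
    refine Finset.sum_eq_zero fun a _ => Finset.sum_eq_zero fun b _ => ?_
    rw [← psi_ev]
    exact psi_JJ D hCH _ _ (hr' b a)
  rw [h2] at h
  have := congrArg TrivSqZeroExt.snd h
  simpa using this.symm

end CHProof

theorem stmt15 (K : Type) [Field K] [CharZero K] (R : Type) [Ring R] [Algebra K R]
    (D : TraceData K R) (n : ℕ) (hCH : IsCayleyHamilton D n) :
    ∃ (S : Type) (_ : CommRing S) (_ : Algebra K S)
      (ρ : R →ₐ[K] Matrix (Fin n) (Fin n) S),
      Function.Injective ρ ∧
      ∀ a : R, ρ (D.Tr a) = Matrix.trace (ρ a) • (1 : Matrix (Fin n) (Fin n) S) := by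
  exact CHProof.main K R D n hCH
end
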